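/- Existence of smoothing operators on Hölder spaces of the unit ball (Proposition 17.1): There exists a family of linear operators S_θ, θ ≥ 1, acting on functions on the closed unit ball Ω ⊂ ℝⁿ, with C^∞ range, such that for all a, b ≥ 0 and all u with finite Hölder norm: (a) ‖S_θ u‖_{a,∞} ≤ C ‖u‖_{b,∞} for a ≤ b; (b) ‖S_θ u‖_{a,∞} ≤ C θ^{a−b} ‖u‖_{b,∞} for a ≥ b; (c) ‖(I − S_θ) u‖_{a,∞} ≤ C θ^{a−b} ‖u‖_{b,∞} for a ≤ b; (d) ‖(S_{2θ} − S_θ) u‖_{a,∞} ≤ C θ^{a−b} ‖u‖_{b,∞} for all a, b ≥ 0; where the constants C depend only on n and upper bounds for a and b. -/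

import Mathlib

open scoped BigOperators
open Set Matrix

noncomputable section

abbrev E' (n : ℕ) := EuclideanSpace ℝ (Fin n)

def Ball (n : ℕ) : Set (E' n) := Metric.closedBall 0 1

def Sphere' (n : ℕ) : Set (E' n) := Metric.sphere 0 1

variable {n : ℕ} {F : Type*} [NormedAddCommGroup F] [NormedSpace ℝ F]

/-- Partial derivative `∂u/∂y^a`. -/
def pd (a : Fin n) (u : E' n → ℝ) (y : E' n) : ℝ :=
  fderiv ℝ u y (EuclideanSpace.single a 1)

/-- Jacobian matrix `∂x^i/∂y^a`. -/
def jacM (x : E' n → E' n) (y : E' n) : Matrix (Fin n) (Fin n) ℝ :=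
  Matrix.of fun i a => pd a (fun z => x z i) y

/-- Metric `g_{ab} = Σ_i (∂x^i/∂y^a)(∂x^i/∂y^b)`. -/
def gMet (x : E' n → E' n) (y : E' n) : Matrix (Fin n) (Fin n) ℝ :=
  (jacM x y)ᵀ * jacM x y

def kappa (x : E' n → E' n) (y : E' n) : ℝ := (jacM x y).det

/-- Eulerian derivative `∂_i u = (∂y^a/∂x^i) ∂_a u`. -/
def epd (x : E' n → E' n) (i : Fin n) (u : E' n → ℝ) (y : E' n) : ℝ :=
  ∑ a, (jacM x y)⁻¹ a i * pd a u y

/-- Laplace–Beltrami operator `Δq = κ⁻¹ ∂_a (κ g^{ab} ∂_b q)`. -/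
def lapl (x : E' n → E' n) (q : E' n → ℝ) (y : E' n) : ℝ :=
  (kappa x y)⁻¹ *
    ∑ a, pd a (fun z => kappa x z * ∑ b, (gMet x z)⁻¹ a b * pd b q z) y

/-- Lagrangian divergence `div W = κ⁻¹ ∂_a (κ W^a)`. -/
def divL (x : E' n → E' n) (W : E' n → Fin n → ℝ) (y : E' n) : ℝ :=
  (kappa x y)⁻¹ * ∑ a, pd a (fun z => kappa x z * W z a) y

/-- Eulerian divergence `div u = ∂_k u^k`. -/
def divE (x : E' n → E' n) (u : E' n → Fin n → ℝ) (y : E' n) : ℝ :=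
  ∑ k, epd x k (fun z => u z k) y

/-- Eulerian curl `curl u_{ij} = ∂_i u_j − ∂_j u_i`. -/
def curlE (x : E' n → E' n) (u : E' n → Fin n → ℝ) (i j : Fin n) (y : E' n) : ℝ :=
  epd x i (fun z => u z j) y - epd x j (fun z => u z i) y

/-- Exterior unit (with respect to `g`) normal derivative on the unit sphere. -/
def gradN (x : E' n → E' n) (p : E' n → ℝ) (y : E' n) : ℝ :=
  (∑ a, ∑ b, (gMet x y)⁻¹ a b * y b * pd a p y) /
    Real.sqrt (∑ a, ∑ b, (gMet x y)⁻¹ a b * y a * y b)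

/-- Coordinate condition `|∂x/∂y|² + |∂y/∂x|² ≤ c₁²`. -/
def coordCond (x : E' n → E' n) (c₁ : ℝ) (y : E' n) : Prop :=
  (∑ i, ∑ a, (jacM x y i a) ^ 2) + (∑ i, ∑ a, ((jacM x y)⁻¹ i a) ^ 2) ≤ c₁ ^ 2

/-- Physical condition `∇_N p ≤ −c₀` on the boundary. -/
def physCond (x : E' n → E' n) (p : E' n → ℝ) (c₀ : ℝ) : Prop :=
  ∀ y ∈ Sphere' n, gradN x p y ≤ -c₀

/-- Material (time) derivative at fixed `y`. -/
def Dt (u : ℝ → E' n → F) : ℝ → E' n → F := fun t y => deriv (fun s => u s y) t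

/-- Iterated time derivative. -/
def Dts (k : ℕ) (u : ℝ → E' n → F) : ℝ → E' n → F := Dt^[k] u

/-- Joint space-time smoothness. -/
def SmoothST (u : ℝ → E' n → F) : Prop :=
  ContDiff ℝ (⊤ : ℕ∞) fun p : ℝ × E' n => u p.1 p.2

/-- `L²` Sobolev norm of order `r` on the unit ball. -/
def sobNorm (r : ℕ) (u : E' n → F) : ℝ :=
  ∑ j ∈ Finset.range (r + 1), (∫ y in Ball n, ‖iteratedFDeriv ℝ j u y‖ ^ 2) ^ ((1:ℝ)/2)

/-- `C^k` supremum norm on the unit ball. -/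
def ckNorm (k : ℕ) (u : E' n → F) : ℝ :=
  ∑ j ∈ Finset.range (k + 1), ⨆ y ∈ Ball n, ‖iteratedFDeriv ℝ j u y‖

/-- Hölder norm of order `a` on the set `s`. -/
def holderNormOn (s : Set (E' n)) (a : ℝ) (u : E' n → F) : ℝ :=
  if a ≤ 0 then ⨆ y ∈ s, ‖u y‖
  else
    (⨆ z ∈ s, ⨆ w ∈ s,
        ‖iteratedFDeriv ℝ (⌈a⌉₊ - 1) u z - iteratedFDeriv ℝ (⌈a⌉₊ - 1) u w‖ /
          ‖z - w‖ ^ (a - ((⌈a⌉₊ : ℝ) - 1))) +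
      ⨆ y ∈ s, ‖u y‖

/-- Hölder norm of order `a` on the unit ball. -/
def holderNorm (a : ℝ) (u : E' n → F) : ℝ := holderNormOn (Ball n) a u

/-- Space-time norm `|||u|||_{a,k}`. -/
def stNorm (T : ℝ) (a : ℝ) (k : ℕ) (u : ℝ → E' n → F) : ℝ :=
  ⨆ t ∈ Icc (0:ℝ) T, ∑ j ∈ Finset.range (k + 1), holderNorm a fun y => Dts j u t y

/-- The defining property of the pressure `p = Ψ(x)`:
`Δp = −(∂_i V^k)(∂_k V^i)` in `Ω`, `p = 0` on `∂Ω`. -/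
def IsPressure (x v : E' n → E' n) (p : E' n → ℝ) : Prop :=
  ContDiff ℝ (⊤ : ℕ∞) p ∧ (∀ y ∈ Sphere' n, p y = 0) ∧
    ∀ y ∈ Ball n,
      lapl x p y = -∑ i, ∑ k, epd x i (fun z => v z k) y * epd x k (fun z => v z i) y

/-- The pressure, selected by choice. -/
def pressureFn (x v : E' n → E' n) : E' n → ℝ := Classical.epsilon (IsPressure x v)

/-- The Euler map `Φ(x)_i = D_t² x_i + ∂_i p`. -/
def eulerMap (x : ℝ → E' n → E' n) : ℝ → E' n → Fin n → ℝ := fun t y i =>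
  Dts 2 x t y i + epd (x t) i (pressureFn (x t) (Dt x t)) y

/-- First variational derivative `Φ'(x)δx`. -/
def eulerMap' (x δx : ℝ → E' n → E' n) : ℝ → E' n → Fin n → ℝ := fun t y i =>
  deriv (fun r : ℝ => eulerMap (fun s z => x s z + r • δx s z) t y i) 0

/-- Second variational derivative `Φ''(x)(δx, εx)`. -/
def eulerMap'' (x δx εx : ℝ → E' n → E' n) : ℝ → E' n → Fin n → ℝ := fun t y i =>
  deriv (fun r : ℝ =>
    deriv (fun s : ℝ => eulerMap (fun τ z => x τ z + r • δx τ z + s • εx τ z) t y i) 0) 0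

/-- Modified linearized operator `L₁ δx = Φ'(x)δx − δx^k ∂_k Φ^i + δx^i div Φ`. -/
def modLin (x δx : ℝ → E' n → E' n) : ℝ → E' n → Fin n → ℝ := fun t y i =>
  eulerMap' x δx t y i
    - (∑ k, δx t y k * epd (x t) k (fun z => eulerMap x t z i) y)
    + δx t y i * ∑ k, epd (x t) k (fun z => eulerMap x t z k) y


/-- Hölder norm of order `a` on a set `s`, using derivatives within `s`. -/
def holderW (s : Set (E' n)) (a : ℝ) (u : E' n → ℝ) : ℝ :=
  if a ≤ 0 then ⨆ y ∈ s, |u y|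
  else
    (⨆ z ∈ s, ⨆ w ∈ s,
        ‖iteratedFDerivWithin ℝ (⌈a⌉₊ - 1) u s z - iteratedFDerivWithin ℝ (⌈a⌉₊ - 1) u s w‖ /
          ‖z - w‖ ^ (a - ((⌈a⌉₊ : ℝ) - 1))) +
      ⨆ y ∈ s, |u y|

/-- `u` has finite Hölder norm of order `a` on `s`. -/
def HolderFin (s : Set (E' n)) (a : ℝ) (u : E' n → ℝ) : Prop :=
  ContDiffOn ℝ ((⌈a⌉₊ - 1 : ℕ) : ℕ∞) u s ∧
  BddAbove ((fun q : E' n × E' n =>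
      ‖iteratedFDerivWithin ℝ (⌈a⌉₊ - 1) u s q.1 - iteratedFDerivWithin ℝ (⌈a⌉₊ - 1) u s q.2‖ /
        ‖q.1 - q.2‖ ^ (a - ((⌈a⌉₊ : ℝ) - 1))) '' (s ×ˢ s)) ∧
  BddAbove ((fun y => |u y|) '' s)

section smoothingOperators

open MeasureTheory Metric
open scoped Convolution

section ball

theorem convex_Ball (n : ℕ) : Convex ℝ (Ball n) := convex_closedBall 0 1

theorem isCompact_Ball (n : ℕ) : IsCompact (Ball n) := isCompact_closedBall 0 1

theorem uniqueDiffOn_Ball (n : ℕ) : UniqueDiffOn ℝ (Ball n) := by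
  refine uniqueDiffOn_convex (convex_Ball n) ⟨0, ?_⟩
  exact ball_subset_interior_closedBall (mem_ball_self one_pos)

theorem mem_Ball {x : E' n} : x ∈ Ball n ↔ ‖x‖ ≤ 1 := by simp [Ball]

/-- The radial retraction of the Euclidean space onto the closed unit ball. -/
def retr (x : E' n) : E' n := (max 1 ‖x‖)⁻¹ • x

theorem retr_mem (x : E' n) : retr x ∈ Ball n := by
  have h : (0 : ℝ) < max 1 ‖x‖ := lt_of_lt_of_le one_pos (le_max_left _ _)
  rw [mem_Ball, retr, norm_smul, norm_inv, Real.norm_of_nonneg h.le, inv_mul_le_iff₀ h, mul_one]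
  exact le_max_right _ _

theorem retr_of_mem {x : E' n} (hx : x ∈ Ball n) : retr x = x := by
  rw [retr, max_eq_left (mem_Ball.1 hx), inv_one, one_smul]

theorem continuous_retr : Continuous (retr : E' n → E' n) := by
  unfold retr
  refine Continuous.smul ((continuous_const.max continuous_norm).inv₀ fun x => ?_) continuous_id
  exact (lt_of_lt_of_le one_pos (le_max_left _ _)).ne'

theorem convexComb_mem {x z : E' n} (hx : x ∈ Ball n) (hz : z ∈ Ball n) {h : ℝ}
    (h0 : 0 ≤ h) (h1 : h ≤ 1) : (1 - h) • x + h • z ∈ Ball n :=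
  convex_Ball n hx hz (by linarith) h0 (by ring)

end ball

section bump

variable (n) in
/-- A smooth bump function supported in the ball of radius one half. -/
def cutoff : ContDiffBump (0 : E' n) := ⟨1 / 4, 1 / 2, by norm_num, by norm_num⟩

variable (n) in
/-- The normalised mollifier, supported in the ball of radius one half. -/
def rho : E' n → ℝ := (cutoff n).normed volume

theorem rho_contDiff : ContDiff ℝ (⊤ : ℕ∞) (rho n) := (cutoff n).contDiff_normed

theorem rho_continuous : Continuous (rho n) := rho_contDiff.continuous

theorem rho_hasCompactSupport : HasCompactSupport (rho n) := (cutoff n).hasCompactSupport_normed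

theorem rho_nonneg (x : E' n) : 0 ≤ rho n x := (cutoff n).nonneg_normed x

theorem rho_neg (x : E' n) : rho n (-x) = rho n x := (cutoff n).normed_neg x

theorem integral_rho : ∫ x, rho n x = 1 := (cutoff n).integral_normed

theorem tsupport_rho : tsupport (rho n) = closedBall 0 (1 / 2) := (cutoff n).tsupport_normed_eq

theorem rho_eq_zero {x : E' n} (hx : 1 / 2 < ‖x‖) : rho n x = 0 := by
  apply image_eq_zero_of_notMem_tsupport
  rw [tsupport_rho]
  simpa using hx

theorem mem_Ball_of_rho_ne_zero {x : E' n} (hx : rho n x ≠ 0) : ‖x‖ ≤ 1 / 2 := by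
  by_contra h
  exact hx (rho_eq_zero (not_le.1 h))

end bump

section mollifier

theorem continuous_comp_retr {G : Type} [TopologicalSpace G] {f : E' n → G}
    (hf : ContinuousOn f (Ball n)) :
    Continuous fun x => f (retr x) :=
  hf.comp_continuous continuous_retr retr_mem

variable {G : Type} [NormedAddCommGroup G] [NormedSpace ℝ G]

/-- The mollification of a function on the unit ball at scale `h`, which averages the values at
convex combinations of the base point with points of the ball. -/
def mol (h : ℝ) (f : E' n → G) (x : E' n) : G :=
  ∫ z, rho n z • f (retr ((1 - h) • x + h • z))

theorem integrable_rho_smul {g : E' n → G} (hg : Continuous g) :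
    Integrable (fun z => rho n z • g z) := by
  refine Continuous.integrable_of_hasCompactSupport (rho_continuous.smul hg) ?_
  exact rho_hasCompactSupport.smul_right

theorem integrable_mol (h : ℝ) {f : E' n → G} (hf : ContinuousOn f (Ball n)) (x : E' n) :
    Integrable (fun z => rho n z • f (retr ((1 - h) • x + h • z))) :=
  integrable_rho_smul (g := fun z => f (retr ((1 - h) • x + h • z)))
    ((continuous_comp_retr hf).comp (by fun_prop))

theorem mol_add (h : ℝ) {f g : E' n → G} (hf : ContinuousOn f (Ball n))
    (hg : ContinuousOn g (Ball n)) : mol h (f + g) = mol h f + mol h g := by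
  funext x
  simp only [mol, Pi.add_apply, smul_add]
  exact integral_add (integrable_mol h hf x) (integrable_mol h hg x)

theorem mol_smul (h c : ℝ) (f : E' n → G) : mol h (c • f) = c • mol h f := by
  funext x
  simp only [mol, Pi.smul_apply, ← integral_smul]
  congr 1
  funext z
  rw [smul_comm]

theorem mol_const [CompleteSpace G] (h : ℝ) (c : G) : mol (n := n) h (fun _ => c) = fun _ => c := by
  funext x
  simp only [mol]
  rw [integral_smul_const, integral_rho, one_smul]

/-- Two averages of functions on the ball against the mollifier are close if the functions are. -/
theorem norm_integral_rho_sub_le {f g : E' n → G} (hf : Continuous f) (hg : Continuous g) {C : ℝ}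
    (h : ∀ z : E' n, ‖z‖ ≤ 1 / 2 → ‖f z - g z‖ ≤ C) :
    ‖(∫ z, rho n z • f z) - ∫ z, rho n z • g z‖ ≤ C := by
  rw [← integral_sub (integrable_rho_smul hf) (integrable_rho_smul hg)]
  calc ‖∫ z, (rho n z • f z - rho n z • g z)‖ ≤ ∫ z, rho n z • C := by
        refine norm_integral_le_of_norm_le (integrable_rho_smul continuous_const) ?_
        filter_upwards with z
        rw [← smul_sub, norm_smul, Real.norm_of_nonneg (rho_nonneg z), smul_eq_mul]
        by_cases hz : rho n z = 0
        · simp [hz]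
        · exact mul_le_mul_of_nonneg_left (h z (mem_Ball_of_rho_ne_zero hz)) (rho_nonneg z)
    _ = C := by rw [integral_smul_const, integral_rho, one_smul]

theorem norm_mol_le {f : E' n → G} (hf : ContinuousOn f (Ball n)) {C : ℝ}
    (hC : ∀ x ∈ Ball n, ‖f x‖ ≤ C) (h : ℝ) (x : E' n) : ‖mol h f x‖ ≤ C := by
  have := norm_integral_rho_sub_le (n := n) (f := fun z => f (retr ((1 - h) • x + h • z)))
    (g := fun _ => (0 : G)) ((continuous_comp_retr hf).comp (by fun_prop)) continuous_const
    (C := C) (fun z _ => by simpa using hC _ (retr_mem _))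
  simpa [mol] using this

/-- After rescaling, the mollification is a convolution with the fixed bump function. -/
theorem mol_eq_convolution {h : ℝ} (h0 : 0 < h) (f : E' n → G) (x : E' n) :
    mol h f x = ((fun t => f (retr (h • t))) ⋆[(ContinuousLinearMap.lsmul ℝ ℝ).flip, volume] rho n)
      (((1 - h) / h) • x) := by
  rw [convolution_def, ← integral_add_left_eq_self _ (((1 - h) / h) • x), mol]
  congr 1
  funext z
  have : h • (((1 - h) / h) • x + z) = (1 - h) • x + h • z := by
    rw [smul_add, smul_smul, mul_div_cancel₀ _ h0.ne']
  simp [this, rho_neg]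

end mollifier

section convolution

/-- Derivatives of a convolution with a smooth compactly supported function are bounded by
the local size of the other factor. -/
theorem norm_iteratedFDeriv_convolution_le {G : Type} [NormedAddCommGroup G] [NormedSpace ℝ G]
    {f : E' n → G} (hf : Continuous f) {s : Set (E' n)} {y : E' n} {A : ℝ}
    (hA : ∀ t, y - t ∈ s → ‖f t‖ ≤ A) (m : ℕ) :
    ∀ {W G' : Type} [NormedAddCommGroup W] [NormedSpace ℝ W] [NormedAddCommGroup G']
      [NormedSpace ℝ G'] (L : G →L[ℝ] W →L[ℝ] G') {g : E' n → W},
      ContDiff ℝ (⊤ : ℕ∞) g → HasCompactSupport g → tsupport g ⊆ s →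
      ‖iteratedFDeriv ℝ m (f ⋆[L, volume] g) y‖ ≤ ‖L‖ * A * ∫ t, ‖iteratedFDeriv ℝ m g t‖ := by
  induction m with
  | zero =>
    intro W G' _ _ _ _ L g hg hgc hgs
    simp only [norm_iteratedFDeriv_zero]
    rw [convolution_def]
    have hint : Integrable (fun t => ‖g (y - t)‖) :=
      ((hg.continuous.integrable_of_hasCompactSupport hgc).comp_sub_left y).norm
    have h2 : ∫ t, ‖g t‖ = ∫ t, ‖g (y - t)‖ :=
      (integral_sub_left_eq_self (fun t => ‖g t‖) volume y).symm
    rw [h2, ← integral_const_mul]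
    refine norm_integral_le_of_norm_le (hint.const_mul _) ?_
    filter_upwards with t
    by_cases ht : y - t ∈ tsupport g
    · refine (L.le_opNorm₂ _ _).trans ?_
      gcongr
      exact hA t (hgs ht)
    · rw [image_eq_zero_of_notMem_tsupport ht]
      simp
  | succ m ih =>
    intro W G' _ _ _ _ L g hg hgc hgs
    have hfd : fderiv ℝ (f ⋆[L, volume] g) =
        f ⋆[L.precompR (E' n), volume] fderiv ℝ g := by
      funext x
      exact (hgc.hasFDerivAt_convolution_right L hf.locallyIntegrable
        (hg.of_le (by exact_mod_cast le_top)) x).fderiv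
    rw [← norm_iteratedFDeriv_fderiv, hfd]
    refine (ih (L.precompR (E' n)) (hg.fderiv_right (by simp)) (hgc.fderiv ℝ)
      ((tsupport_fderiv_subset ℝ).trans hgs)).trans ?_
    simp only [norm_iteratedFDeriv_fderiv]
    by_cases hs : s.Nonempty
    · obtain ⟨w, hw⟩ := hs
      have hA0 : 0 ≤ A := (norm_nonneg _).trans (hA (y - w) (by simpa using hw))
      gcongr
      exact L.norm_precompR_le (E' n)
    · have : g = 0 := by
        rw [not_nonempty_iff_eq_empty.1 hs, subset_empty_iff, tsupport_eq_empty_iff] at hgs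
        exact hgs
      subst this
      simp [Pi.zero_def]
      
end convolution

section mollifierDerivatives

variable {G : Type} [NormedAddCommGroup G] [NormedSpace ℝ G]

theorem contDiff_mol {h : ℝ} (h0 : 0 < h) {f : E' n → G} (hf : ContinuousOn f (Ball n)) :
    ContDiff ℝ (⊤ : ℕ∞) (mol h f) := by
  have hc : Continuous fun t : E' n => f (retr (h • t)) :=
    (continuous_comp_retr hf).comp (by fun_prop)
  rw [show mol h f = _ from funext (mol_eq_convolution h0 f)]
  exact (rho_hasCompactSupport.contDiff_convolution_right _ hc.locallyIntegrable
    rho_contDiff).comp (contDiff_const_smul _)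

theorem norm_lsmul_flip_le : ‖(ContinuousLinearMap.lsmul ℝ ℝ : ℝ →L[ℝ] G →L[ℝ] G).flip‖ ≤ 1 := by
  rw [ContinuousLinearMap.opNorm_flip]
  exact ContinuousLinearMap.opNorm_lsmul_le

theorem norm_iteratedFDerivWithin_mol_le_of_local (m : ℕ) {h : ℝ} (h0 : 0 < h) (h1 : h ≤ 1)
    {f : E' n → G} (hf : ContinuousOn f (Ball n)) {x : E' n} (hx : x ∈ Ball n) {A : ℝ}
    (hA : ∀ w ∈ Ball n, ‖w - (1 - h) • x‖ ≤ h → ‖f w‖ ≤ A) :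
    ‖iteratedFDerivWithin ℝ m (mol h f) (Ball n) x‖ ≤
      (∫ t, ‖iteratedFDeriv ℝ m (rho n) t‖) * (h⁻¹ ^ m * A) := by
  have hc : Continuous fun t : E' n => f (retr (h • t)) :=
    (continuous_comp_retr hf).comp (by fun_prop)
  have hs : ContDiff ℝ (⊤ : ℕ∞) ((fun t => f (retr (h • t)))
      ⋆[(ContinuousLinearMap.lsmul ℝ ℝ).flip, volume] rho n) :=
    rho_hasCompactSupport.contDiff_convolution_right _ hc.locallyIntegrable rho_contDiff
  have hA0 : 0 ≤ A := by
    refine (norm_nonneg _).trans (hA ((1 - h) • x) ?_ (by simpa using h0.le))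
    simpa using convexComb_mem hx (z := 0) (by simp [Ball]) h0.le h1
  have hx1 : ‖x‖ ≤ 1 := mem_Ball.1 hx
  have hr0 : 0 ≤ (1 - h) / h := div_nonneg (by linarith) h0.le
  have hr1 : (1 - h) / h ≤ h⁻¹ := by
    rw [div_eq_mul_inv]
    exact mul_le_of_le_one_left (inv_nonneg.2 h0.le) (by linarith)
  rw [iteratedFDerivWithin_eq_iteratedFDeriv (uniqueDiffOn_Ball n)
    ((contDiff_mol h0 hf).contDiffAt.of_le (by exact_mod_cast le_top)) hx,
    show mol h f = _ from funext (mol_eq_convolution h0 f),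
    iteratedFDeriv_comp_const_smul _ (i := m) (hs.of_le (by exact_mod_cast le_top))]
  simp only [norm_smul, norm_pow, Real.norm_of_nonneg hr0]
  have key := norm_iteratedFDeriv_convolution_le hc (s := closedBall 0 (1 / 2))
    (y := ((1 - h) / h) • x) (A := A) (fun t ht => ?_) m
    (ContinuousLinearMap.lsmul ℝ ℝ : ℝ →L[ℝ] G →L[ℝ] G).flip rho_contDiff
    rho_hasCompactSupport tsupport_rho.le
  · have hI : 0 ≤ ∫ t, ‖iteratedFDeriv ℝ m (rho n) t‖ := integral_nonneg fun _ => norm_nonneg _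
    have key2 := key.trans (mul_le_mul_of_nonneg_right
      (mul_le_of_le_one_left hA0 norm_lsmul_flip_le) hI)
    calc _ ≤ h⁻¹ ^ m * (A * ∫ t, ‖iteratedFDeriv ℝ m (rho n) t‖) := by gcongr
      _ = _ := by ring
  · have ht1 : ‖((1 - h) / h) • x - t‖ ≤ 1 / 2 := by simpa using ht
    have hd : ‖h • t - (1 - h) • x‖ ≤ h / 2 := by
      have : h • t - (1 - h) • x = (-h) • (((1 - h) / h) • x - t) := by
        rw [smul_sub, smul_smul, neg_mul, mul_div_cancel₀ _ h0.ne', neg_smul, neg_smul]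
        abel
      rw [this, norm_smul, norm_neg, Real.norm_of_nonneg h0.le]
      nlinarith
    have hmem : h • t ∈ Ball n := by
      rw [mem_Ball]
      have h2 : ‖(1 - h) • x‖ ≤ 1 - h := by
        rw [norm_smul, Real.norm_of_nonneg (by linarith)]
        nlinarith
      have h3 := norm_add_le (h • t - (1 - h) • x) ((1 - h) • x)
      rw [sub_add_cancel] at h3
      linarith
    rw [retr_of_mem hmem]
    exact hA _ hmem (by linarith)

theorem norm_iteratedFDerivWithin_mol_le_of_holder [CompleteSpace G] {m : ℕ} (hm : m ≠ 0) {h : ℝ}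
    (h0 : 0 < h) (h1 : h ≤ 1) {f : E' n → G} (hf : ContinuousOn f (Ball n)) {β K : ℝ}
    (hβ : 0 ≤ β) (hK : 0 ≤ K) (hfK : ∀ z ∈ Ball n, ∀ w ∈ Ball n, ‖f z - f w‖ ≤ K * ‖z - w‖ ^ β)
    {x : E' n} (hx : x ∈ Ball n) :
    ‖iteratedFDerivWithin ℝ m (mol h f) (Ball n) x‖ ≤
      (∫ t, ‖iteratedFDeriv ℝ m (rho n) t‖) * (h⁻¹ ^ m * (K * h ^ β)) := by
  have hy : (1 - h) • x ∈ Ball n := by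
    simpa using convexComb_mem hx (z := 0) (by simp [Ball]) h0.le h1
  set c : G := f ((1 - h) • x)
  have hg : ContinuousOn (fun w => f w - c) (Ball n) := hf.sub continuousOn_const
  have hsplit : mol h f = mol h (fun w => f w - c) + fun _ => c := by
    rw [← mol_const (n := n) h c, ← mol_add h hg continuousOn_const]
    congr 1
    funext w
    simp
  have hder : iteratedFDerivWithin ℝ m (mol h f) (Ball n) x =
      iteratedFDerivWithin ℝ m (mol h (fun w => f w - c)) (Ball n) x := by
    rw [hsplit, iteratedFDerivWithin_add_apply
      ((contDiff_mol h0 hg).contDiffAt.contDiffWithinAt.of_le (by exact_mod_cast le_top))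
      contDiffWithinAt_const (uniqueDiffOn_Ball n) hx, iteratedFDerivWithin_const_of_ne hm]
    simp
  rw [hder]
  refine norm_iteratedFDerivWithin_mol_le_of_local m h0 h1 hg hx fun w hw hwh => ?_
  refine (hfK w hw _ hy).trans ?_
  gcongr

theorem fderivWithin_mol {h : ℝ} (h0 : 0 < h) (h1 : h ≤ 1) {f : E' n → G}
    (hf : ContDiffOn ℝ 1 f (Ball n)) {x : E' n} (hx : x ∈ Ball n) :
    fderivWithin ℝ (mol h f) (Ball n) x =
      (1 - h) • mol h (fderivWithin ℝ f (Ball n)) x := by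
  set f' := fderivWithin ℝ f (Ball n)
  have hf'c : ContinuousOn f' (Ball n) :=
    hf.continuousOn_fderivWithin (uniqueDiffOn_Ball n) le_rfl
  have hfd : DifferentiableOn ℝ f (Ball n) := hf.differentiableOn one_ne_zero
  obtain ⟨C, hC⟩ := (isCompact_Ball n).exists_bound_of_continuousOn hf'c
  have hC0 : 0 ≤ C := (norm_nonneg _).trans (hC 0 (by simp [Ball]))
  have hx1 := mem_Ball.1 hx
  have hint : ∀ y ∈ ball x (h / 2), ∀ z : E' n, ‖z‖ ≤ 1 / 2 →
      (1 - h) • y + h • z ∈ ball (0 : E' n) 1 := by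
    intro y hy z hz
    rw [mem_ball_zero_iff]
    have hy' : ‖y - x‖ < h / 2 := by simpa [dist_eq_norm] using hy
    have hyn : ‖y‖ < 1 + h / 2 := by
      have := norm_add_le (y - x) x
      rw [sub_add_cancel] at this
      linarith
    calc ‖(1 - h) • y + h • z‖ ≤ (1 - h) * ‖y‖ + h * ‖z‖ := by
          refine (norm_add_le _ _).trans_eq ?_
          rw [norm_smul, norm_smul, Real.norm_of_nonneg h0.le, Real.norm_of_nonneg (by linarith)]
      _ < 1 := by nlinarith
  have key : HasFDerivAt (mol h f)
      (∫ z, rho n z • (1 - h) • f' (retr ((1 - h) • x + h • z))) x := by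
    refine hasFDerivAt_integral_of_dominated_of_fderiv_le (s := ball x (h / 2))
      (bound := fun z => rho n z • C)
      (F' := fun y z => rho n z • (1 - h) • f' (retr ((1 - h) • y + h • z)))
      (ball_mem_nhds x (by linarith)) ?_ (integrable_mol h hf.continuousOn x) ?_ ?_
      (integrable_rho_smul continuous_const) ?_
    · exact Filter.Eventually.of_forall fun y =>
        (integrable_mol h hf.continuousOn y).aestronglyMeasurable
    · refine (integrable_rho_smul (g := fun z => (1 - h) • f' (retr ((1 - h) • x + h • z)))
        ?_).aestronglyMeasurable
      have hcz : Continuous fun z : E' n => f' (retr ((1 - h) • x + h • z)) :=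
        (continuous_comp_retr hf'c).comp (by fun_prop)
      exact hcz.const_smul (1 - h)
    · refine Filter.Eventually.of_forall fun z y _ => ?_
      rw [norm_smul, Real.norm_of_nonneg (rho_nonneg z), norm_smul,
        Real.norm_of_nonneg (by linarith : 0 ≤ 1 - h), smul_eq_mul]
      refine mul_le_mul_of_nonneg_left ?_ (rho_nonneg z)
      have := hC _ (retr_mem ((1 - h) • y + h • z))
      nlinarith [norm_nonneg (f' (retr ((1 - h) • y + h • z)))]
    · refine Filter.Eventually.of_forall fun z y hy => ?_
      by_cases hz : rho n z = 0
      · simpa [hz] using hasFDerivAt_const (0 : G) y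
      refine HasFDerivAt.const_smul ?_ _
      have hb := hint y hy z (mem_Ball_of_rho_ne_zero hz)
      have hbB := ball_subset_closedBall hb
      rw [retr_of_mem hbB]
      have hnhds : Ball n ∈ nhds ((1 - h) • y + h • z) :=
        Filter.mem_of_superset (isOpen_ball.mem_nhds hb) ball_subset_closedBall
      have hfa : HasFDerivAt f (f' ((1 - h) • y + h • z)) ((1 - h) • y + h • z) :=
        (hfd _ hbB).hasFDerivWithinAt.hasFDerivAt hnhds
      have hfr : HasFDerivAt (fun w => f (retr w)) (f' ((1 - h) • y + h • z))
          ((1 - h) • y + h • z) := by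
        refine hfa.congr_of_eventuallyEq ?_
        filter_upwards [hnhds] with w hw
        rw [retr_of_mem hw]
      have haff : HasFDerivAt (fun w : E' n => (1 - h) • w + h • z)
          ((1 - h) • ContinuousLinearMap.id ℝ (E' n)) y :=
        ((hasFDerivAt_id y).const_smul (1 - h)).add_const _
      refine (hfr.comp y haff).congr_fderiv ?_
      ext v
      simp
  rw [key.hasFDerivWithinAt.fderivWithin (uniqueDiffOn_Ball n x hx), mol, ← integral_smul]
  congr 1
  funext z
  rw [smul_comm]

end mollifierDerivatives

section holderSeminorm

variable {G : Type} [NormedAddCommGroup G] [NormedSpace ℝ G]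

/-- The `k`-th derivative of `f` on the ball is Hölder continuous of exponent `β` with
constant `K`. -/
def HolderSemi (k : ℕ) (β K : ℝ) (f : E' n → G) : Prop :=
  ContDiffOn ℝ k f (Ball n) ∧ ∀ z ∈ Ball n, ∀ w ∈ Ball n,
    ‖iteratedFDerivWithin ℝ k f (Ball n) z - iteratedFDerivWithin ℝ k f (Ball n) w‖ ≤
      K * ‖z - w‖ ^ β

theorem norm_iteratedFDerivWithin_succ_sub (k : ℕ) (f : E' n → G) {z w : E' n} (hz : z ∈ Ball n)
    (hw : w ∈ Ball n) :
    ‖iteratedFDerivWithin ℝ (k + 1) f (Ball n) z - iteratedFDerivWithin ℝ (k + 1) f (Ball n) w‖ =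
      ‖iteratedFDerivWithin ℝ k (fderivWithin ℝ f (Ball n)) (Ball n) z -
        iteratedFDerivWithin ℝ k (fderivWithin ℝ f (Ball n)) (Ball n) w‖ := by
  rw [iteratedFDerivWithin_succ_eq_comp_right (uniqueDiffOn_Ball n) hz,
    iteratedFDerivWithin_succ_eq_comp_right (uniqueDiffOn_Ball n) hw, Function.comp_apply,
    Function.comp_apply, ← dist_eq_norm, ← dist_eq_norm]
  exact LinearIsometryEquiv.dist_map _ _ _

theorem norm_iteratedFDerivWithin_zero_sub (f : E' n → G) (z w : E' n) :
    ‖iteratedFDerivWithin ℝ 0 f (Ball n) z - iteratedFDerivWithin ℝ 0 f (Ball n) w‖ =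
      ‖f z - f w‖ := by
  rw [iteratedFDerivWithin_zero_eq_comp, Function.comp_apply, Function.comp_apply, ← map_sub,
    LinearIsometryEquiv.norm_map]

theorem HolderSemi.contDiffOn_one {k : ℕ} {β K : ℝ} {f : E' n → G}
    (hf : HolderSemi (k + 1) β K f) : ContDiffOn ℝ 1 f (Ball n) :=
  hf.1.of_le (by norm_cast; omega)

theorem HolderSemi.fderivWithin {k : ℕ} {β K : ℝ} {f : E' n → G}
    (hf : HolderSemi (k + 1) β K f) : HolderSemi k β K (fderivWithin ℝ f (Ball n)) := by
  refine ⟨?_, fun z hz w hw => ?_⟩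
  · exact hf.1.fderivWithin (uniqueDiffOn_Ball n) (by norm_cast)
  · rw [← norm_iteratedFDerivWithin_succ_sub k f hz hw]
    exact hf.2 z hz w hw

theorem iteratedFDerivWithin_fderivWithin_mol {h : ℝ} (h0 : 0 < h) (h1 : h ≤ 1) {f : E' n → G}
    (hf : ContDiffOn ℝ 1 f (Ball n)) (m : ℕ) {x : E' n} (hx : x ∈ Ball n) :
    iteratedFDerivWithin ℝ m (fderivWithin ℝ (mol h f) (Ball n)) (Ball n) x =
      (1 - h) • iteratedFDerivWithin ℝ m (mol h (fderivWithin ℝ f (Ball n))) (Ball n) x := by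
  rw [iteratedFDerivWithin_congr (fun y hy => fderivWithin_mol h0 h1 hf hy) hx]
  have hc : ContDiffWithinAt ℝ m (mol h (fderivWithin ℝ f (Ball n))) (Ball n) x :=
    (contDiff_mol h0 (hf.continuousOn_fderivWithin (uniqueDiffOn_Ball n)
      le_rfl)).contDiffAt.contDiffWithinAt.of_le (by exact_mod_cast le_top)
  exact iteratedFDerivWithin_const_smul_apply (a := 1 - h) hc (uniqueDiffOn_Ball n) hx

theorem norm_iteratedFDerivWithin_mol_le {m : ℕ} (hm : m ≠ 0) {h β K : ℝ} (h0 : 0 < h)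
    (h1 : h ≤ 1) (hβ : 0 ≤ β) (hK : 0 ≤ K) {x : E' n} (hx : x ∈ Ball n) (k : ℕ) :
    ∀ {G : Type} [NormedAddCommGroup G] [NormedSpace ℝ G] [CompleteSpace G] {f : E' n → G},
      HolderSemi k β K f →
      ‖iteratedFDerivWithin ℝ (m + k) (mol h f) (Ball n) x‖ ≤
        (∫ t, ‖iteratedFDeriv ℝ m (rho n) t‖) * (h⁻¹ ^ m * (K * h ^ β)) := by
  induction k with
  | zero =>
    intro G _ _ _ f hf
    refine norm_iteratedFDerivWithin_mol_le_of_holder hm h0 h1 hf.1.continuousOn hβ hK ?_ hx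
    intro z hz w hw
    rw [← norm_iteratedFDerivWithin_zero_sub]
    exact hf.2 z hz w hw
  | succ k ih =>
    intro G _ _ _ f hf
    rw [← add_assoc, ← norm_iteratedFDerivWithin_fderivWithin (uniqueDiffOn_Ball n) hx,
      iteratedFDerivWithin_fderivWithin_mol h0 h1 hf.contDiffOn_one _ hx, norm_smul,
      Real.norm_of_nonneg (by linarith)]
    exact (mul_le_of_le_one_left (norm_nonneg _) (by linarith)).trans (ih hf.fderivWithin)

theorem norm_iteratedFDerivWithin_mol_sub_le {h β K : ℝ} (h0 : 0 < h)
    (h1 : h ≤ 1) (hβ : 0 ≤ β) (hK : 0 ≤ K) {x y : E' n} (hx : x ∈ Ball n) (hy : y ∈ Ball n)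
    (k : ℕ) :
    ∀ {G : Type} [NormedAddCommGroup G] [NormedSpace ℝ G] [CompleteSpace G] {f : E' n → G},
      HolderSemi k β K f →
      ‖iteratedFDerivWithin ℝ k (mol h f) (Ball n) x -
        iteratedFDerivWithin ℝ k (mol h f) (Ball n) y‖ ≤ K * ‖x - y‖ ^ β := by
  induction k with
  | zero =>
    intro G _ _ _ f hf
    rw [norm_iteratedFDerivWithin_zero_sub]
    have hc := continuous_comp_retr hf.1.continuousOn
    refine norm_integral_rho_sub_le (f := fun z => f (retr ((1 - h) • x + h • z)))
      (g := fun z => f (retr ((1 - h) • y + h • z))) (hc.comp (by fun_prop))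
      (hc.comp (by fun_prop)) fun z hz => ?_
    have hzB : z ∈ Ball n := mem_Ball.2 (by linarith)
    have hzx := convexComb_mem hx hzB h0.le h1
    have hzy := convexComb_mem hy hzB h0.le h1
    rw [retr_of_mem hzx, retr_of_mem hzy, ← norm_iteratedFDerivWithin_zero_sub]
    refine (hf.2 _ hzx _ hzy).trans ?_
    gcongr
    rw [add_sub_add_right_eq_sub, ← smul_sub, norm_smul, Real.norm_of_nonneg (by linarith)]
    exact mul_le_of_le_one_left (norm_nonneg _) (by linarith)
  | succ k ih =>
    intro G _ _ _ f hf
    rw [norm_iteratedFDerivWithin_succ_sub _ _ hx hy,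
      iteratedFDerivWithin_fderivWithin_mol h0 h1 hf.contDiffOn_one _ hx,
      iteratedFDerivWithin_fderivWithin_mol h0 h1 hf.contDiffOn_one _ hy, ← smul_sub, norm_smul,
      Real.norm_of_nonneg (by linarith)]
    exact (mul_le_of_le_one_left (norm_nonneg _) (by linarith)).trans (ih hf.fderivWithin)

/-- Taylor expansion along rays of a function with a Hölder continuous derivative. -/
theorem exists_taylor_of_holderSemi {β K : ℝ} (hβ0 : 0 < β) (hβ1 : β ≤ 1) (hK : 0 ≤ K)
    {x z : E' n} (hx : x ∈ Ball n) (hz : z ∈ Ball n) (k : ℕ) :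
    ∀ {G : Type} [NormedAddCommGroup G] [NormedSpace ℝ G] {f : E' n → G},
      HolderSemi k β K f → ∃ p : ℕ → G, p 0 = f x ∧ ∀ t : ℝ, 0 ≤ t → t ≤ 1 →
        ‖f ((1 - t) • x + t • z) - ∑ i ∈ Finset.range (k + 1), t ^ i • p i‖ ≤
          2 ^ (k + 1) * K * (t ^ k * t ^ β) := by
  have hzx : ‖z - x‖ ≤ 2 := by
    refine (norm_sub_le _ _).trans ?_
    linarith [mem_Ball.1 hx, mem_Ball.1 hz]
  induction k with
  | zero =>
    intro G _ _ f hf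
    refine ⟨fun _ => f x, rfl, fun t ht0 ht1 => ?_⟩
    have h1 := hf.2 _ (convexComb_mem hx hz ht0 ht1) x hx
    rw [norm_iteratedFDerivWithin_zero_sub] at h1
    have h2 : (1 - t) • x + t • z - x = t • (z - x) := by
      rw [sub_smul, one_smul, smul_sub]
      abel
    rw [h2, norm_smul, Real.norm_of_nonneg ht0, Real.mul_rpow ht0 (norm_nonneg _)] at h1
    have h3 : ‖z - x‖ ^ β ≤ 2 := by
      calc ‖z - x‖ ^ β ≤ 2 ^ β := by gcongr
        _ ≤ (2 : ℝ) ^ (1 : ℝ) := Real.rpow_le_rpow_of_exponent_le one_le_two hβ1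
        _ = 2 := Real.rpow_one 2
    have h4 : 0 ≤ t ^ β := Real.rpow_nonneg ht0 β
    simp only [zero_add, Finset.range_one, Finset.sum_singleton, pow_zero, one_smul, pow_one,
      one_mul]
    calc _ ≤ K * (t ^ β * ‖z - x‖ ^ β) := h1
      _ ≤ K * (t ^ β * 2) := by gcongr
      _ = _ := by ring
  | succ k ih =>
    intro G _ _ f hf
    obtain ⟨p', -, hp'⟩ := ih hf.fderivWithin
    set p : ℕ → G := fun i => Nat.casesOn i (f x) fun j => ((j : ℝ) + 1)⁻¹ • p' j (z - x) with hp
    refine ⟨p, rfl, fun t ht0 ht1 => ?_⟩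
    have hfd : DifferentiableOn ℝ f (Ball n) := hf.contDiffOn_one.differentiableOn one_ne_zero
    have hpoly : ∀ s : ℝ, HasDerivAt (fun s : ℝ => ∑ i ∈ Finset.range (k + 1 + 1), s ^ i • p i)
        ((∑ i ∈ Finset.range (k + 1), s ^ i • p' i) (z - x)) s := by
      intro s
      have h1 : ∀ i ∈ Finset.range (k + 1 + 1), HasDerivAt (fun s : ℝ => s ^ i • p i)
          (((i : ℝ) * s ^ (i - 1)) • p i) s := fun i _ => (hasDerivAt_pow i s).smul_const (p i)
      refine (HasDerivAt.fun_sum h1).congr_deriv ?_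
      rw [Finset.sum_range_succ', _root_.sum_apply]
      simp only [Nat.cast_zero, zero_mul, zero_smul, add_zero]
      refine Finset.sum_congr rfl fun i _ => ?_
      have hi : (i : ℝ) + 1 ≠ 0 := by positivity
      simp only [hp, Nat.cast_add, Nat.cast_one, Nat.add_sub_cancel, smul_smul,
        _root_.smul_apply]
      congr 1
      field_simp
    have hray : ∀ s ∈ Icc (0 : ℝ) t, HasDerivWithinAt (fun s : ℝ => f ((1 - s) • x + s • z))
        (_root_.fderivWithin ℝ f (Ball n) ((1 - s) • x + s • z) (z - x)) (Icc 0 t) s := by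
      intro s hs
      have hmem := convexComb_mem hx hz hs.1 (hs.2.trans ht1)
      have haff : HasDerivWithinAt (fun s : ℝ => (1 - s) • x + s • z) (z - x) (Icc 0 t) s := by
        have h1 := (((hasDerivAt_id s).const_sub 1).smul_const x).add
          ((hasDerivAt_id s).smul_const z)
        refine (h1.congr_deriv ?_).hasDerivWithinAt
        simp only [neg_smul, one_smul]
        abel
      exact (hfd _ hmem).hasFDerivWithinAt.comp_hasDerivWithinAt s haff fun r hr =>
        convexComb_mem hx hz hr.1 (hr.2.trans ht1)
    have hmv := norm_image_sub_le_of_norm_deriv_le_segment'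
      (f := fun s : ℝ => f ((1 - s) • x + s • z) - ∑ i ∈ Finset.range (k + 1 + 1), s ^ i • p i)
      (C := 2 ^ (k + 1) * K * (t ^ k * t ^ β) * 2) (a := 0) (b := t)
      (fun s hs => (hray s hs).sub (hpoly s).hasDerivWithinAt) (fun s hs => ?_) t
      (right_mem_Icc.2 ht0)
    · have h0 : ∑ i ∈ Finset.range (k + 1 + 1), (0 : ℝ) ^ i • p i = f x := by
        rw [Finset.sum_range_succ']
        simp [hp]
      simp only [sub_zero, one_smul, zero_smul, add_zero, h0, sub_self] at hmv
      refine hmv.trans_eq ?_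
      ring
    · rw [← _root_.sub_apply]
      refine (ContinuousLinearMap.le_opNorm _ _).trans ?_
      have hs1 := hs.2.le
      have hs0 := hs.1
      refine mul_le_mul ((hp' s hs.1 (hs1.trans ht1)).trans ?_) hzx (norm_nonneg _)
        (by positivity)
      gcongr

end holderSeminorm

section extrapolation

open Finset in
/-- The Lagrange weight at `0` of the `j`-th of the first `M` nodes in geometric progression of
ratio four. -/
def extrapWeight (M j : ℕ) : ℝ :=
  ∏ i ∈ range M, if i = j then 1 else (4 : ℝ) ^ i / (4 ^ i - 4 ^ j)

theorem sum_extrapWeight_mul_eval {M : ℕ} {h : ℝ} (h0 : h ≠ 0) {Q : Polynomial ℝ}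
    (hQ : Q.degree < M) :
    ∑ j ∈ Finset.range M, extrapWeight M j * Q.eval (h * 4 ^ j) = Q.eval 0 := by
  have hinj : Function.Injective fun j : ℕ => h * (4 : ℝ) ^ j := by
    intro i j hij
    exact pow_right_injective₀ (by norm_num) (by norm_num) (mul_left_cancel₀ h0 hij)
  have hQ' := Lagrange.eq_interpolate (s := Finset.range M) (v := fun j : ℕ => h * (4 : ℝ) ^ j)
    (f := Q) hinj.injOn (by simpa using hQ)
  conv_rhs => rw [hQ', Lagrange.interpolate_apply, Polynomial.eval_finsetSum]
  refine Finset.sum_congr rfl fun j hj => ?_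
  rw [Polynomial.eval_mul, Polynomial.eval_C, mul_comm]
  congr 1
  rw [extrapWeight, ← Finset.mul_prod_erase _ _ hj, if_pos rfl, one_mul, Lagrange.basis,
    Polynomial.eval_prod]
  refine Finset.prod_congr rfl fun i hi => ?_
  have hij : i ≠ j := Finset.ne_of_mem_erase hi
  have hne : (4 : ℝ) ^ i - 4 ^ j ≠ 0 := by
    rw [sub_ne_zero]
    exact fun he => hij (pow_right_injective₀ (by norm_num) (by norm_num) he)
  have hne' : h * (4 : ℝ) ^ j - h * 4 ^ i ≠ 0 := by
    rw [← mul_sub]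
    exact mul_ne_zero h0 (by rwa [← neg_sub, neg_ne_zero])
  rw [if_neg hij]
  simp only [Lagrange.basisDivisor, Polynomial.eval_mul, Polynomial.eval_C, Polynomial.eval_sub,
    Polynomial.eval_X]
  field_simp
  rw [eq_div_iff (by rwa [← neg_sub, neg_ne_zero])]
  ring

theorem abs_extrapWeight_le {M j : ℕ} (hj : j < M) :
    |extrapWeight M j| ≤ Real.exp 1 * ∏ d ∈ Finset.range j, 2 * (1 / 4 : ℝ) ^ (d + 1) := by
  obtain ⟨m, rfl⟩ := Nat.exists_eq_add_of_lt hj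
  rw [show j + m + 1 = j + 1 + m by ring, extrapWeight, Finset.prod_range_add,
    Finset.prod_range_succ, if_pos rfl, mul_one, abs_mul, Finset.abs_prod, Finset.abs_prod,
    mul_comm]
  refine mul_le_mul ?_ ?_ (by positivity) (by positivity)
  · calc _ ≤ ∏ d ∈ Finset.range m, Real.exp (2 * (1 / 4 : ℝ) ^ (d + 1)) := by
          refine Finset.prod_le_prod (fun _ _ => abs_nonneg _) fun d _ => ?_
          rw [if_neg (by omega)]
          have h4 : (0 : ℝ) < 4 ^ j := by positivity
          have hx0 : (0 : ℝ) < (1 / 4) ^ (d + 1) := by positivity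
          have hx1 : (1 / 4 : ℝ) ^ (d + 1) ≤ 1 / 4 :=
            pow_le_of_le_one (by norm_num) (by norm_num) (by omega)
          have hx : (4 : ℝ) ^ (j + 1 + d) * (1 / 4) ^ (d + 1) = 4 ^ j := by
            rw [show j + 1 + d = j + (d + 1) by ring, pow_add, mul_assoc, ← mul_pow]
            norm_num
          have hp : (0 : ℝ) < 4 ^ (j + 1 + d) := by positivity
          have hden : (0 : ℝ) < 4 ^ (j + 1 + d) - 4 ^ j := by nlinarith
          rw [abs_of_pos (div_pos hp hden), div_le_iff₀ hden]
          have he := Real.add_one_le_exp (2 * (1 / 4 : ℝ) ^ (d + 1))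
          refine le_trans ?_ (mul_le_mul_of_nonneg_right he hden.le)
          nlinarith [mul_pos hp hx0]
      _ = Real.exp (∑ d ∈ Finset.range m, 2 * (1 / 4 : ℝ) ^ (d + 1)) := (Real.exp_sum _ _).symm
      _ ≤ Real.exp 1 := by
          refine Real.exp_le_exp.2 ?_
          have hs : ∀ k : ℕ, ∑ d ∈ Finset.range k, 2 * (1 / 4 : ℝ) ^ (d + 1) =
              2 / 3 * (1 - (1 / 4) ^ k) := by
            intro k
            induction k with
            | zero => simp
            | succ k ih => rw [Finset.sum_range_succ, ih, pow_succ]; ring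
          rw [hs]
          have : (0 : ℝ) < (1 / 4) ^ m := by positivity
          linarith
  · rw [← Finset.prod_range_reflect (fun d => 2 * (1 / 4 : ℝ) ^ (d + 1))]
    refine Finset.prod_le_prod (fun _ _ => abs_nonneg _) fun i hi => ?_
    have hij : i < j := Finset.mem_range.1 hi
    rw [if_neg hij.ne, show j - 1 - i + 1 = j - i by omega]
    have hx0 : (0 : ℝ) < (1 / 4) ^ (j - i) := by positivity
    have hx1 : (1 / 4 : ℝ) ^ (j - i) ≤ 1 / 4 :=
      pow_le_of_le_one (by norm_num) (by norm_num) (by omega)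
    have hx : (4 : ℝ) ^ j * (1 / 4) ^ (j - i) = 4 ^ i := by
      conv_lhs => rw [← Nat.add_sub_of_le hij.le]
      rw [Nat.add_sub_cancel_left, pow_add, mul_assoc, ← mul_pow]
      norm_num
    have hp : (0 : ℝ) < 4 ^ j := by positivity
    have hpi : (0 : ℝ) < 4 ^ i := by positivity
    have hden : (0 : ℝ) < 4 ^ j - 4 ^ i := by nlinarith
    rw [abs_div, abs_of_pos hpi, abs_sub_comm, abs_of_pos hden, div_le_iff₀ hden]
    nlinarith [mul_pos hpi hx0]

theorem exists_sum_abs_extrapWeight_le (B : ℕ) : ∃ C : ℝ, 0 < C ∧ ∀ M : ℕ,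
    ∑ j ∈ Finset.range M, |extrapWeight M j| * ((4 : ℝ) ^ j) ^ B ≤ C := by
  set a : ℕ → ℝ := fun j => (∏ d ∈ Finset.range j, 2 * (1 / 4 : ℝ) ^ (d + 1)) * ((4 : ℝ) ^ j) ^ B
  have ha : ∀ j, 0 < a j := fun j => by positivity
  have hsum : Summable a := by
    refine summable_of_ratio_test_tendsto_lt_one (l := 0) one_pos
      (Filter.Eventually.of_forall fun j => (ha j).ne') ?_
    have : ∀ j, ‖a (j + 1)‖ / ‖a j‖ = 2 * 4 ^ B * (1 / 4 : ℝ) ^ (j + 1) := by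
      intro j
      rw [Real.norm_of_nonneg (ha _).le, Real.norm_of_nonneg (ha _).le, div_eq_iff (ha j).ne']
      simp only [a]
      rw [Finset.prod_range_succ, pow_succ 4 j, mul_pow]
      ring
    simp only [this]
    have h := ((tendsto_pow_atTop_nhds_zero_of_lt_one (r := (1 / 4 : ℝ)) (by norm_num)
      (by norm_num)).comp (Filter.tendsto_add_atTop_nat 1)).const_mul (2 * 4 ^ B)
    simpa using h
  refine ⟨Real.exp 1 * ∑' j, a j, mul_pos (Real.exp_pos 1) (hsum.tsum_pos (fun j => (ha j).le) 0
    (ha 0)), fun M => ?_⟩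
  calc _ ≤ ∑ j ∈ Finset.range M, Real.exp 1 * a j := by
        refine Finset.sum_le_sum fun j hj => ?_
        simp only [a]
        rw [← mul_assoc]
        exact mul_le_mul_of_nonneg_right (abs_extrapWeight_le (Finset.mem_range.1 hj))
          (by positivity)
    _ ≤ _ := by
        rw [← Finset.mul_sum]
        exact mul_le_mul_of_nonneg_left (hsum.sum_le_tsum _ fun j _ => (ha j).le)
          (Real.exp_pos 1).le

end extrapolation

section richardson

variable {G : Type} [NormedAddCommGroup G] [NormedSpace ℝ G]

/-- Richardson extrapolation of the averages of `f` at the scales `h * 4 ^ j`, `j < M`, damped by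
the `r`-th power of `1 - h * 4 ^ j`. -/
def rich (M : ℕ) (h : ℝ) (r : ℕ) (f : E' n → G) (x : E' n) : G :=
  ∑ j ∈ Finset.range M, (extrapWeight M j * (1 - h * 4 ^ j) ^ r) • mol (h * 4 ^ j) f x

theorem contDiff_rich {M : ℕ} {h : ℝ} (h0 : 0 < h) (r : ℕ) {f : E' n → G}
    (hf : ContinuousOn f (Ball n)) : ContDiff ℝ (⊤ : ℕ∞) (rich M h r f) := by
  unfold rich
  exact ContDiff.sum fun j _ => (contDiff_mol (by positivity) hf).const_smul _

theorem sum_extrapWeight_mul_pow {M r i : ℕ} {h : ℝ} (h0 : h ≠ 0) (hi : i + r < M) :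
    ∑ j ∈ Finset.range M, extrapWeight M j * (1 - h * 4 ^ j) ^ r * (h * 4 ^ j) ^ i =
      if i = 0 then 1 else 0 := by
  have hd : (Polynomial.X ^ i * (1 - Polynomial.X) ^ r : Polynomial ℝ).degree < M := by
    refine lt_of_le_of_lt (Polynomial.degree_le_of_natDegree_le (n := i + r) ?_)
      (by exact_mod_cast hi)
    compute_degree
  have h1 := sum_extrapWeight_mul_eval h0 hd
  simp only [Polynomial.eval_mul, Polynomial.eval_pow, Polynomial.eval_X, Polynomial.eval_sub,
    Polynomial.eval_one, sub_zero, one_pow, mul_one] at h1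
  rw [zero_pow_eq] at h1
  rw [← h1]
  exact Finset.sum_congr rfl fun j _ => by ring

theorem norm_sub_rich_le [CompleteSpace G] {M r k : ℕ} (hM : k + r < M) {h C : ℝ} (h0 : 0 < h)
    (h1 : ∀ j < M, h * 4 ^ j ≤ 1 / 2)
    (hC : ∑ j ∈ Finset.range M, |extrapWeight M j| * ((4 : ℝ) ^ j) ^ (k + 1) ≤ C) {β K : ℝ}
    (hβ0 : 0 < β) (hβ1 : β ≤ 1) (hK : 0 ≤ K) {f : E' n → G} (hf : HolderSemi k β K f)
    {x : E' n} (hx : x ∈ Ball n) :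
    ‖f x - rich M h r f x‖ ≤ 2 ^ (k + 1) * C * (K * (h ^ k * h ^ β)) := by
  have hc := continuous_comp_retr hf.1.continuousOn
  have hint : rich M h r f x = ∫ z, rho n z • ∑ j ∈ Finset.range M,
      (extrapWeight M j * (1 - h * 4 ^ j) ^ r) •
        f (retr ((1 - h * 4 ^ j) • x + (h * 4 ^ j) • z)) := by
    simp only [Finset.smul_sum]
    rw [integral_finsetSum]
    · refine Finset.sum_congr rfl fun j _ => ?_
      rw [mol, ← integral_smul]
      refine integral_congr_ae (Filter.Eventually.of_forall fun z => ?_)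
      exact smul_comm _ _ _
    · intro j _
      exact integrable_rho_smul ((hc.comp (by fun_prop)).const_smul _)
  have hconst : f x = ∫ z, rho n z • f x := by
    rw [integral_smul_const, integral_rho, one_smul]
  rw [hint]
  nth_rw 1 [hconst]
  refine norm_integral_rho_sub_le continuous_const
    (continuous_finsetSum _ fun j _ => (hc.comp (by fun_prop)).const_smul _) fun z hz => ?_
  have hzB : z ∈ Ball n := mem_Ball.2 (by linarith)
  obtain ⟨p, hp0, hp⟩ := exists_taylor_of_holderSemi hβ0 hβ1 hK hx hzB k hf
  have hpoly : ∑ j ∈ Finset.range M, (extrapWeight M j * (1 - h * 4 ^ j) ^ r) •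
      ∑ i ∈ Finset.range (k + 1), (h * 4 ^ j) ^ i • p i = f x := by
    simp only [Finset.smul_sum, smul_smul]
    rw [Finset.sum_comm]
    simp only [← Finset.sum_smul]
    rw [Finset.sum_eq_single 0]
    · rw [sum_extrapWeight_mul_pow h0.ne' (by omega), if_pos rfl, one_smul, hp0]
    · intro i hi hi0
      have := Finset.mem_range.1 hi
      rw [sum_extrapWeight_mul_pow h0.ne' (by omega), if_neg hi0, zero_smul]
    · simp
  rw [← hpoly, ← Finset.sum_sub_distrib]
  simp only [Pi.smul_apply, Function.comp_apply, ← smul_sub]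
  calc _ ≤ ∑ j ∈ Finset.range M,
        2 ^ (k + 1) * (K * (h ^ k * h ^ β)) * (|extrapWeight M j| * ((4 : ℝ) ^ j) ^ (k + 1)) := by
        refine norm_sum_le_of_le _ fun j hj => ?_
        have hj1 := h1 j (Finset.mem_range.1 hj)
        have hj0 : 0 < h * 4 ^ j := by positivity
        have h4 : (1 : ℝ) ≤ 4 ^ j := one_le_pow₀ (by norm_num)
        rw [norm_smul, norm_mul, norm_pow, Real.norm_eq_abs,
          Real.norm_of_nonneg (by linarith : 0 ≤ 1 - h * 4 ^ j), norm_sub_rev,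
          retr_of_mem (convexComb_mem hx hzB hj0.le (by linarith))]
        have hpow : (1 - h * 4 ^ j) ^ r ≤ 1 := pow_le_one₀ (by linarith) (by linarith)
        have hβ : (h * 4 ^ j) ^ β ≤ h ^ β * 4 ^ j := by
          rw [Real.mul_rpow h0.le (by positivity)]
          gcongr
          simpa using Real.rpow_le_rpow_of_exponent_le h4 hβ1
        calc _ ≤ |extrapWeight M j| * 1 *
              (2 ^ (k + 1) * K * ((h * 4 ^ j) ^ k * (h ^ β * 4 ^ j))) := by
              gcongr
              exact (hp _ hj0.le (by linarith)).trans (by gcongr)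
          _ = _ := by rw [mul_pow]; ring
    _ ≤ 2 ^ (k + 1) * (K * (h ^ k * h ^ β)) * C := by
        rw [← Finset.mul_sum]
        gcongr
    _ = _ := by ring

theorem fderivWithin_sub_rich [CompleteSpace G] {M : ℕ} (r : ℕ) {h : ℝ} (h0 : 0 < h)
    (h1 : ∀ j < M, h * 4 ^ j ≤ 1 / 2) {f : E' n → G} (hf : ContDiffOn ℝ 1 f (Ball n)) {x : E' n}
    (hx : x ∈ Ball n) :
    fderivWithin ℝ (fun y => f y - rich M h r f y) (Ball n) x =
      fderivWithin ℝ f (Ball n) x - rich M h (r + 1) (fderivWithin ℝ f (Ball n)) x := by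
  have hmol : ∀ j : ℕ, DifferentiableAt ℝ (mol (h * 4 ^ j) f) x := fun j =>
    (contDiff_mol (by positivity) hf.continuousOn).differentiable (by simp) x
  have hsm : DifferentiableAt ℝ (rich M h r f) x :=
    (contDiff_rich h0 r hf.continuousOn).differentiable (by simp) x
  have hu := uniqueDiffOn_Ball n x hx
  rw [fderivWithin_fun_sub hu (hf.differentiableOn one_ne_zero x hx) hsm.differentiableWithinAt]
  congr 1
  have he : rich M h r f = fun y => ∑ j ∈ Finset.range M,
    (extrapWeight M j * (1 - h * 4 ^ j) ^ r) • mol (h * 4 ^ j) f y := rfl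
  rw [he, fderivWithin_fun_sum (A := fun j y => (extrapWeight M j * (1 - h * 4 ^ j) ^ r) •
    mol (h * 4 ^ j) f y) hu fun j _ => ((hmol j).const_smul _).differentiableWithinAt]
  refine Finset.sum_congr rfl fun j hj => ?_
  rw [fderivWithin_fun_const_smul hu (hmol j).differentiableWithinAt, fderivWithin_mol
    (by positivity) (by linarith [h1 j (Finset.mem_range.1 hj)]) hf hx, smul_smul, pow_succ,
    mul_assoc]

theorem norm_iteratedFDerivWithin_sub_rich_le {M k : ℕ} {h C : ℝ} (h0 : 0 < h)
    (h1 : ∀ j < M, h * 4 ^ j ≤ 1 / 2)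
    (hC : ∑ j ∈ Finset.range M, |extrapWeight M j| * ((4 : ℝ) ^ j) ^ (k + 1) ≤ C) {β K : ℝ}
    (hβ0 : 0 < β) (hβ1 : β ≤ 1) (hK : 0 ≤ K) {x : E' n} (hx : x ∈ Ball n) (l : ℕ) :
    ∀ {G : Type} [NormedAddCommGroup G] [NormedSpace ℝ G] [CompleteSpace G] {f : E' n → G} {r : ℕ},
      k + l + r < M → HolderSemi (k + l) β K f →
      ‖iteratedFDerivWithin ℝ l (fun y => f y - rich M h r f y) (Ball n) x‖ ≤
        2 ^ (k + 1) * C * (K * (h ^ k * h ^ β)) := by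
  induction l with
  | zero =>
    intro G _ _ _ f r hM hf
    rw [norm_iteratedFDerivWithin_zero]
    exact norm_sub_rich_le hM h0 h1 hC hβ0 hβ1 hK hf hx
  | succ l ih =>
    intro G _ _ _ f r hM hf
    rw [← norm_iteratedFDerivWithin_fderivWithin (uniqueDiffOn_Ball n) hx,
      iteratedFDerivWithin_congr (fun y hy => fderivWithin_sub_rich r h0 h1
        (HolderSemi.contDiffOn_one (k := k + l) hf) hy) hx]
    exact ih (r := r + 1) (by omega) (HolderSemi.fderivWithin (k := k + l) hf)

end richardson

section interpolation

/-- Interpolation between two bounds of the same homogeneity. -/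
theorem le_mul_rpow_of_le_of_le {D X h r γ γ' δ δ' α : ℝ} (hX : 0 ≤ X) (h0 : 0 < h) (r0 : 0 ≤ r)
    (hα : 0 < α) (h1 : D ≤ X * (h ^ γ * r ^ δ)) (h2 : D ≤ X * (h ^ γ' * r ^ δ'))
    (hγ : γ + δ = γ' + δ') (hδ : δ ≤ α) (hδ' : α ≤ δ') :
    D ≤ X * h ^ (γ + δ - α) * r ^ α := by
  rcases r0.eq_or_lt with rfl | r0
  · rw [Real.zero_rpow (by linarith), mul_zero, mul_zero] at h2
    exact h2.trans (by positivity)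
  rw [mul_assoc]
  rcases le_total r h with hr | hr
  · refine h2.trans (mul_le_mul_of_nonneg_left ?_ hX)
    calc h ^ γ' * r ^ δ' = h ^ γ' * (r ^ (δ' - α) * r ^ α) := by
          rw [← Real.rpow_add r0, sub_add_cancel]
      _ ≤ h ^ γ' * (h ^ (δ' - α) * r ^ α) := by
          gcongr
      _ = _ := by
          rw [← mul_assoc, ← Real.rpow_add h0]
          congr 2
          linarith
  · refine h1.trans (mul_le_mul_of_nonneg_left ?_ hX)
    calc h ^ γ * r ^ δ = h ^ γ * (r ^ (δ - α) * r ^ α) := by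
          rw [← Real.rpow_add r0, sub_add_cancel]
      _ ≤ h ^ γ * (h ^ (δ - α) * r ^ α) := by
          gcongr h ^ γ * (?_ * r ^ α)
          exact Real.rpow_le_rpow_of_nonpos h0 hr (by linarith)
      _ = _ := by
          rw [← mul_assoc, ← Real.rpow_add h0]
          congr 2
          linarith

end interpolation

section holderSeminormClosure

variable {G : Type} [NormedAddCommGroup G] [NormedSpace ℝ G]

theorem norm_iteratedFDerivWithin_sub_le_of_succ {l : ℕ} {f : E' n → G} {C : ℝ}
    (hf : ContDiffOn ℝ (l + 1 : ℕ) f (Ball n))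
    (hC : ∀ x ∈ Ball n, ‖iteratedFDerivWithin ℝ (l + 1) f (Ball n) x‖ ≤ C) {x y : E' n}
    (hx : x ∈ Ball n) (hy : y ∈ Ball n) :
    ‖iteratedFDerivWithin ℝ l f (Ball n) x - iteratedFDerivWithin ℝ l f (Ball n) y‖ ≤
      C * ‖x - y‖ := by
  refine (convex_Ball n).norm_image_sub_le_of_norm_fderivWithin_le (𝕜 := ℝ)
    (hf.differentiableOn_iteratedFDerivWithin (by norm_cast; omega) (uniqueDiffOn_Ball n))
    (fun z hz => ?_) hy hx
  rw [norm_fderivWithin_iteratedFDerivWithin]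
  exact hC z hz

theorem HolderSemi.mono {k : ℕ} {β K L : ℝ} {f : E' n → G} (hf : HolderSemi k β K f)
    (hKL : K ≤ L) : HolderSemi k β L f :=
  ⟨hf.1, fun z hz w hw => (hf.2 z hz w hw).trans (by gcongr)⟩

theorem HolderSemi.add {k : ℕ} {β K L : ℝ} {f g : E' n → G} (hf : HolderSemi k β K f)
    (hg : HolderSemi k β L g) : HolderSemi k β (K + L) (fun x => f x + g x) := by
  refine ⟨hf.1.add hg.1, fun z hz w hw => ?_⟩
  have hu := uniqueDiffOn_Ball n
  rw [fun_iteratedFDerivWithin_add_apply (hf.1 z hz) (hg.1 z hz) hu hz,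
    fun_iteratedFDerivWithin_add_apply (hf.1 w hw) (hg.1 w hw) hu hw, add_sub_add_comm, add_mul]
  exact norm_add_le_of_le (hf.2 z hz w hw) (hg.2 z hz w hw)

theorem HolderSemi.const_smul {k : ℕ} {β K : ℝ} {f : E' n → G} (hf : HolderSemi k β K f)
    (c : ℝ) : HolderSemi k β (|c| * K) (fun x => c • f x) := by
  refine ⟨hf.1.const_smul c, fun z hz w hw => ?_⟩
  have hu := uniqueDiffOn_Ball n
  rw [show (fun x => c • f x) = c • f from rfl,
    iteratedFDerivWithin_const_smul_apply (hf.1 z hz) hu hz,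
    iteratedFDerivWithin_const_smul_apply (hf.1 w hw) hu hw, ← smul_sub, norm_smul,
    Real.norm_eq_abs, mul_assoc]
  exact mul_le_mul_of_nonneg_left (hf.2 z hz w hw) (abs_nonneg c)

theorem holderSemi_zero (k : ℕ) (β : ℝ) : HolderSemi k β 0 (fun _ : E' n => (0 : G)) :=
  ⟨contDiffOn_const, fun z _ w _ => by simp [iteratedFDerivWithin_fun_zero]⟩

theorem HolderSemi.sum_smul {k : ℕ} {β K : ℝ} (s : Finset ℕ) (c : ℕ → ℝ) {g : ℕ → E' n → G}
    (hg : ∀ j ∈ s, HolderSemi k β K (g j)) :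
    HolderSemi k β ((∑ j ∈ s, |c j|) * K) (fun x => ∑ j ∈ s, c j • g j x) := by
  induction s using Finset.induction_on with
  | empty => simpa using holderSemi_zero k β
  | insert i s hi ih =>
    simp only [Finset.sum_insert hi, add_mul]
    exact ((hg i (Finset.mem_insert_self _ _)).const_smul _).add
      (ih fun j hj => hg j (Finset.mem_insert_of_mem hj))

/-- The averages gain regularity, at the price of negative powers of the scale. -/
theorem exists_holderSemi_mol (n k l : ℕ) (hkl : k ≤ l) : ∃ C : ℝ, 0 < C ∧
    ∀ (β α h K : ℝ) (f : E' n → ℝ), 0 ≤ β → 0 < α → α ≤ 1 → k + β ≤ l + α →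
      0 < h → h ≤ 1 → 0 ≤ K → HolderSemi k β K f →
      HolderSemi l α (C * h ^ ((k + β) - (l + α)) * K) (mol h f) := by
  obtain ⟨m, rfl⟩ := Nat.exists_eq_add_of_le hkl
  set I : ℕ → ℝ := fun m => ∫ t, ‖iteratedFDeriv ℝ m (rho n) t‖ with hI
  have hI0 : ∀ m, 0 ≤ I m := fun m => integral_nonneg fun t => norm_nonneg _
  have := hI0 m
  have := hI0 (m + 1)
  refine ⟨I (m + 1) + 2 * I m + 1, by positivity, fun β α h K f hβ hα0 hα1 hle h0 h1 hK hf => ?_⟩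
  have hsm : ContDiff ℝ (⊤ : ℕ∞) (mol h f) := contDiff_mol h0 hf.1.continuousOn
  have hsm' : ∀ j : ℕ, ContDiffOn ℝ j (mol h f) (Ball n) := fun j =>
    hsm.contDiffOn.of_le (by exact_mod_cast le_top)
  have hpow : ∀ j : ℕ, h⁻¹ ^ j * h ^ β = h ^ (β - j) := fun j => by
    rw [Real.rpow_sub h0, Real.rpow_natCast, inv_pow]
    ring
  refine ⟨hsm' _, fun z hz w hw => ?_⟩
  have hder : ∀ j : ℕ, j ≠ 0 → ∀ x ∈ Ball n,
      ‖iteratedFDerivWithin ℝ (k + j) (mol h f) (Ball n) x‖ ≤ I j * K * h ^ (β - j) := by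
    intro j hj x hx
    rw [add_comm k j, ← hpow]
    exact (norm_iteratedFDerivWithin_mol_le hj h0 h1 hβ hK hx k hf).trans_eq (by ring)
  have hlip := norm_iteratedFDerivWithin_sub_le_of_succ (hsm' _) (hder (m + 1) (by omega)) hz hw
  have hlip' : ‖iteratedFDerivWithin ℝ (k + m) (mol h f) (Ball n) z -
      iteratedFDerivWithin ℝ (k + m) (mol h f) (Ball n) w‖ ≤
      ((I (m + 1) + 2 * I m + 1) * K) * (h ^ (β - m - 1) * ‖z - w‖ ^ (1 : ℝ)) := by
    refine hlip.trans ?_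
    rw [Real.rpow_one, ← mul_assoc]
    push_cast
    rw [← sub_sub]
    gcongr
    linarith
  rcases Nat.eq_zero_or_pos m with rfl | hm
  · have hH := norm_iteratedFDerivWithin_mol_sub_le h0 h1 hβ hK hz hw k hf
    simp only [Nat.cast_zero, add_zero, sub_zero, zero_add] at *
    have key := le_mul_rpow_of_le_of_le (γ := 0) (δ := β) (X := (I 1 + 2 * I 0 + 1) * K)
      (by positivity) h0 (norm_nonneg (z - w)) hα0 ?_ hlip' (by ring) (by linarith) hα1
    · refine key.trans_eq ?_
      rw [show (k : ℝ) + β - (k + α) = 0 + β - α by ring]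
      ring
    · refine hH.trans ?_
      rw [Real.rpow_zero, one_mul]
      gcongr
      nlinarith
  · have hH : ‖iteratedFDerivWithin ℝ (k + m) (mol h f) (Ball n) z -
        iteratedFDerivWithin ℝ (k + m) (mol h f) (Ball n) w‖ ≤
        ((I (m + 1) + 2 * I m + 1) * K) * (h ^ (β - m) * ‖z - w‖ ^ (0 : ℝ)) := by
      refine (norm_sub_le_of_le (hder m hm.ne' z hz) (hder m hm.ne' w hw)).trans ?_
      rw [Real.rpow_zero, mul_one, ← two_mul, ← mul_assoc, ← mul_assoc]
      gcongr
      linarith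
    have key := le_mul_rpow_of_le_of_le (by positivity) h0 (norm_nonneg (z - w)) hα0 hH hlip'
      (by ring) hα0.le hα1
    refine key.trans_eq ?_
    push_cast
    rw [show (k : ℝ) + β - (k + m + α) = β - m + 0 - α by ring]
    ring

/-- The error of the extrapolated averages. -/
theorem holderSemi_sub_rich {M k l : ℕ} {h C : ℝ} (h0 : 0 < h) (hlk : l ≤ k) (hM : k < M)
    (h1 : ∀ j < M, h * 4 ^ j ≤ 1 / 2)
    (hC : ∑ j ∈ Finset.range M, |extrapWeight M j| * ((4 : ℝ) ^ j) ^ (k + 1) ≤ C) {β α K : ℝ}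
    (hβ0 : 0 < β) (hβ1 : β ≤ 1) (hα0 : 0 < α) (hα1 : α ≤ 1) (hle : l + α ≤ k + β) (hK : 0 ≤ K)
    {f : E' n → ℝ} (hf : HolderSemi k β K f) :
    HolderSemi l α ((2 * (2 ^ (k + 1) * C) + 1) * h ^ ((k + β) - (l + α)) * K)
      (fun y => f y - rich M h 0 f y) := by
  have hC0 : ∑ j ∈ Finset.range M, |extrapWeight M j| ≤ C := by
    refine le_trans (Finset.sum_le_sum fun j _ => ?_) hC
    exact le_mul_of_one_le_right (abs_nonneg _) (one_le_pow₀ (one_le_pow₀ (by norm_num)))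
  have hCn : 0 ≤ C := le_trans (Finset.sum_nonneg fun j _ => by positivity) hC
  have hsm : ContDiffOn ℝ k (fun y => f y - rich M h 0 f y) (Ball n) :=
    hf.1.sub ((contDiff_rich h0 0 hf.1.continuousOn).contDiffOn.of_le (by exact_mod_cast le_top))
  have hder : ∀ i j : ℕ, i + j = k → ∀ x ∈ Ball n,
      ‖iteratedFDerivWithin ℝ j (fun y => f y - rich M h 0 f y) (Ball n) x‖ ≤
        2 ^ (k + 1) * C * K * h ^ (i + β) := by
    rintro i j rfl x hx
    refine (norm_iteratedFDerivWithin_sub_rich_le h0 h1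
      (C := C) ?_ hβ0 hβ1 hK hx j (by omega) hf).trans ?_
    · refine le_trans (Finset.sum_le_sum fun j _ => ?_) hC
      gcongr ?_ * ?_
      exact pow_le_pow_right₀ (one_le_pow₀ (by norm_num)) (by omega)
    · rw [Real.rpow_add h0, Real.rpow_natCast, ← mul_assoc]
      gcongr
      · norm_num
      · omega
  refine ⟨hsm.of_le (by exact_mod_cast hlk), fun z hz w hw => ?_⟩
  obtain ⟨m, rfl⟩ := Nat.exists_eq_add_of_le hlk
  set D : ℝ := 2 ^ (l + m + 1) * C with hD
  have hD0 : 0 ≤ D := by positivity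
  have hCD : C ≤ D := le_mul_of_one_le_left hCn (one_le_pow₀ one_le_two)
  have hX : 0 ≤ (2 * D + 1) * K := by positivity
  have hlow : ‖iteratedFDerivWithin ℝ l (fun y => f y - rich M h 0 f y) (Ball n) z -
      iteratedFDerivWithin ℝ l (fun y => f y - rich M h 0 f y) (Ball n) w‖ ≤
      ((2 * D + 1) * K) * (h ^ (m + β) * ‖z - w‖ ^ (0 : ℝ)) := by
    refine (norm_sub_le_of_le (hder m l (by omega) z hz) (hder m l (by omega) w hw)).trans ?_
    rw [Real.rpow_zero, mul_one, ← two_mul, ← mul_assoc, ← mul_assoc]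
    gcongr
    linarith
  rcases Nat.eq_zero_or_pos m with rfl | hm
  · have hmol : ∀ j ∈ Finset.range M, HolderSemi l β K (mol (h * 4 ^ j) f) := by
      intro j hj
      have hj0 : 0 < h * 4 ^ j := by positivity
      have hj1 := h1 j (Finset.mem_range.1 hj)
      refine ⟨(contDiff_mol hj0 hf.1.continuousOn).contDiffOn.of_le (by exact_mod_cast le_top),
        fun z hz w hw => ?_⟩
      exact norm_iteratedFDerivWithin_mol_sub_le hj0 (by linarith) hβ0.le hK hz hw l hf
    have hdiff := HolderSemi.add hf ((HolderSemi.sum_smul (Finset.range M) (extrapWeight M)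
      hmol).const_smul (-1))
    have he : (fun y => f y - rich M h 0 f y) = fun y => f y + (-1 : ℝ) •
        ∑ j ∈ Finset.range M, extrapWeight M j • mol (h * 4 ^ j) f y := by
      funext y
      simp [rich, sub_eq_add_neg]
    rw [← he] at hdiff
    have hup : ‖iteratedFDerivWithin ℝ l (fun y => f y - rich M h 0 f y) (Ball n) z -
        iteratedFDerivWithin ℝ l (fun y => f y - rich M h 0 f y) (Ball n) w‖ ≤
        ((2 * D + 1) * K) * (h ^ (0 : ℝ) * ‖z - w‖ ^ β) := by
      refine (hdiff.2 z hz w hw).trans ?_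
      rw [Real.rpow_zero, one_mul, abs_neg, abs_one, one_mul]
      gcongr
      nlinarith
    simp only [Nat.cast_zero, add_zero, zero_add] at hlow hle ⊢
    have key := le_mul_rpow_of_le_of_le hX h0 (norm_nonneg (z - w)) hα0 hlow hup (by ring) hα0.le
      (by linarith)
    refine key.trans_eq ?_
    rw [show (l : ℝ) + β - (l + α) = β + 0 - α by ring]
    ring
  · obtain ⟨m, rfl⟩ := Nat.exists_eq_succ_of_ne_zero hm.ne'
    have hlip := norm_iteratedFDerivWithin_sub_le_of_succ (l := l)
      (hsm.of_le (by norm_cast; omega)) (hder m (l + 1) (by omega)) hz hw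
    have key := le_mul_rpow_of_le_of_le (γ' := m + β) (δ' := 1) hX h0 (norm_nonneg (z - w)) hα0
      hlow ?_ (by push_cast; ring) hα0.le hα1
    · refine key.trans_eq ?_
      push_cast
      rw [show (l : ℝ) + (m + 1) + β - (l + α) = m + 1 + β + 0 - α by ring]
      ring
    · refine hlip.trans ?_
      rw [Real.rpow_one, ← mul_assoc]
      gcongr
      linarith

end holderSeminormClosure

section holderBound

/-- The Hölder norm of order `a` of `u` on the ball is, up to a factor two, at most `N`. -/
def HolderBd (a N : ℝ) (u : E' n → ℝ) : Prop :=
  ContinuousOn u (Ball n) ∧ (∀ y ∈ Ball n, |u y| ≤ N) ∧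
    (0 < a → HolderSemi (⌈a⌉₊ - 1) (a - ((⌈a⌉₊ : ℝ) - 1)) N u)

theorem eq_zero_or_eq_natCast_add {a : ℝ} (ha : 0 ≤ a) :
    a = 0 ∨ ∃ (k : ℕ) (β : ℝ), 0 < β ∧ β ≤ 1 ∧ a = k + β := by
  rcases ha.eq_or_lt with h | h
  · exact Or.inl h.symm
  · have h1 : 1 ≤ ⌈a⌉₊ := Nat.one_le_ceil_iff.2 h
    refine Or.inr ⟨⌈a⌉₊ - 1, a - ((⌈a⌉₊ - 1 : ℕ) : ℝ), ?_, ?_, by ring⟩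
    · have := Nat.ceil_lt_add_one ha
      push_cast [h1]
      linarith
    · have := Nat.le_ceil a
      push_cast [h1]
      linarith

theorem holderBd_zero_iff {N : ℝ} {u : E' n → ℝ} :
    HolderBd 0 N u ↔ ContinuousOn u (Ball n) ∧ ∀ y ∈ Ball n, |u y| ≤ N := by
  simp [HolderBd]

theorem holderBd_natCast_add_iff {k : ℕ} {β N : ℝ} (hβ0 : 0 < β) (hβ1 : β ≤ 1) {u : E' n → ℝ} :
    HolderBd (k + β) N u ↔ HolderSemi k β N u ∧ ∀ y ∈ Ball n, |u y| ≤ N := by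
  have hc : ⌈(k : ℝ) + β⌉₊ = k + 1 := by
    rw [add_comm, Nat.ceil_add_natCast hβ0.le, add_comm]
    congr 1
    rw [Nat.ceil_eq_iff one_ne_zero]
    constructor <;> simpa
  have hpos : 0 < (k : ℝ) + β := by positivity
  rw [HolderBd, hc, Nat.add_sub_cancel]
  push_cast
  rw [add_sub_cancel_right, add_sub_cancel_left]
  exact ⟨fun h => ⟨h.2.2 hpos, h.2.1⟩, fun h => ⟨h.1.1.continuousOn, h.2, fun _ => h.1⟩⟩

theorem HolderBd.nonneg {a N : ℝ} {u : E' n → ℝ} (h : HolderBd a N u) : 0 ≤ N :=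
  (abs_nonneg _).trans (h.2.1 0 (mem_Ball.2 (by simp)))

theorem HolderBd.zero {a N : ℝ} {u : E' n → ℝ} (h : HolderBd a N u) : HolderBd 0 N u :=
  holderBd_zero_iff.2 ⟨h.1, h.2.1⟩

theorem HolderBd.mono {a N N' : ℝ} {u : E' n → ℝ} (h : HolderBd a N u) (hN : N ≤ N') :
    HolderBd a N' u :=
  ⟨h.1, fun y hy => (h.2.1 y hy).trans hN, fun ha => (h.2.2 ha).mono hN⟩

theorem HolderBd.add {a N N' : ℝ} {u v : E' n → ℝ} (hu : HolderBd a N u) (hv : HolderBd a N' v) :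
    HolderBd a (N + N') (fun y => u y + v y) :=
  ⟨hu.1.add hv.1, fun y hy => (abs_add_le _ _).trans (add_le_add (hu.2.1 y hy) (hv.2.1 y hy)),
    fun ha => (hu.2.2 ha).add (hv.2.2 ha)⟩

theorem HolderBd.const_smul {a N : ℝ} {u : E' n → ℝ} (hu : HolderBd a N u) (c : ℝ) :
    HolderBd a (|c| * N) (fun y => c • u y) := by
  refine ⟨hu.1.const_smul c, fun y hy => ?_, fun ha => (hu.2.2 ha).const_smul c⟩
  refine (abs_mul c (u y)).trans_le ?_
  exact mul_le_mul_of_nonneg_left (hu.2.1 y hy) (abs_nonneg c)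

theorem HolderBd.sub {a N N' : ℝ} {u v : E' n → ℝ} (hu : HolderBd a N u) (hv : HolderBd a N' v) :
    HolderBd a (N + N') (fun y => u y - v y) := by
  simpa [sub_eq_add_neg] using hu.add (hv.const_smul (-1))

theorem HolderBd.sum_smul {a N : ℝ} (s : Finset ℕ) (c : ℕ → ℝ) {g : ℕ → E' n → ℝ}
    (hg : ∀ j ∈ s, HolderBd a N (g j)) :
    HolderBd a ((∑ j ∈ s, |c j|) * N) (fun x => ∑ j ∈ s, c j • g j x) := by
  induction s using Finset.induction_on with
  | empty =>
    simp only [Finset.sum_empty, zero_mul]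
    exact ⟨continuousOn_const, by simp, fun _ => holderSemi_zero _ _⟩
  | insert i s hi ih =>
    simp only [Finset.sum_insert hi, add_mul]
    exact ((hg i (Finset.mem_insert_self _ _)).const_smul _).add
      (ih fun j hj => hg j (Finset.mem_insert_of_mem hj))

theorem HolderBd.exists_holderSemi {b N : ℝ} {u : E' n → ℝ} (hb : 0 ≤ b) (hu : HolderBd b N u) :
    ∃ (k : ℕ) (β : ℝ), 0 ≤ β ∧ β ≤ 1 ∧ (β = 0 → k = 0) ∧ b = k + β ∧
      HolderSemi k β (2 * N) u := by
  have hN := hu.nonneg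
  rcases eq_zero_or_eq_natCast_add hb with rfl | ⟨k, β, hβ0, hβ1, rfl⟩
  · refine ⟨0, 0, le_rfl, zero_le_one, fun _ => rfl, by simp, ?_, fun z hz w hw => ?_⟩
    · exact contDiffOn_zero.2 hu.1
    · rw [norm_iteratedFDerivWithin_zero_sub, Real.rpow_zero, mul_one, two_mul]
      exact norm_sub_le_of_le (hu.2.1 z hz) (hu.2.1 w hw)
  · exact ⟨k, β, hβ0.le, hβ1, fun h => absurd h hβ0.ne', rfl,
      ((holderBd_natCast_add_iff hβ0 hβ1).1 hu).1.mono (by linarith)⟩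

theorem exists_holderBd_mol (n : ℕ) (A : ℝ) : ∃ C : ℝ, 0 < C ∧
    ∀ (a b h N : ℝ) (u : E' n → ℝ), 0 ≤ b → b ≤ a → a ≤ A → 0 < h → h ≤ 1 → HolderBd b N u →
      HolderBd a (C * h ^ (b - a) * N) (mol h u) := by
  have hex : ∀ k l : ℕ, ∃ C : ℝ, 0 < C ∧ (k ≤ l → ∀ (β α h K : ℝ) (f : E' n → ℝ),
      0 ≤ β → 0 < α → α ≤ 1 → k + β ≤ l + α → 0 < h → h ≤ 1 → 0 ≤ K → HolderSemi k β K f →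
      HolderSemi l α (C * h ^ ((k + β) - (l + α)) * K) (mol h f)) := by
    intro k l
    by_cases hkl : k ≤ l
    · obtain ⟨C, hC, H⟩ := exists_holderSemi_mol n k l hkl
      exact ⟨C, hC, fun _ => H⟩
    · exact ⟨1, one_pos, fun h => absurd h hkl⟩
  choose c hc H using hex
  set B : ℕ := ⌈A⌉₊ + 1 with hB
  have hle : ∀ k < B, ∀ l < B, c k l ≤ ∑ i ∈ Finset.range B, ∑ j ∈ Finset.range B, c i j := by
    intro k hk l hl
    refine le_trans ?_ (Finset.single_le_sum (f := fun i => ∑ j ∈ Finset.range B, c i j)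
      (fun i _ => Finset.sum_nonneg fun j _ => (hc i j).le) (Finset.mem_range.2 hk))
    exact Finset.single_le_sum (fun j _ => (hc k j).le) (Finset.mem_range.2 hl)
  have hS : 0 ≤ ∑ i ∈ Finset.range B, ∑ j ∈ Finset.range B, c i j :=
    Finset.sum_nonneg fun i _ => Finset.sum_nonneg fun j _ => (hc i j).le
  set S : ℝ := ∑ i ∈ Finset.range B, ∑ j ∈ Finset.range B, c i j
  refine ⟨2 * S + 1, by positivity, fun a b h N u hb hba haA h0 h1 hu => ?_⟩
  have hN := hu.nonneg
  have hp : 1 ≤ h ^ (b - a) := Real.one_le_rpow_of_pos_of_le_one_of_nonpos h0 h1 (by linarith)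
  have hsup : ∀ y ∈ Ball n, |mol h u y| ≤ (2 * S + 1) * h ^ (b - a) * N := fun y _ =>
    (norm_mol_le hu.1 hu.2.1 h y).trans
      (le_mul_of_one_le_left hN (one_le_mul_of_one_le_of_one_le (by linarith) hp))
  rcases eq_zero_or_eq_natCast_add (hb.trans hba) with rfl | ⟨l, α, hα0, hα1, rfl⟩
  · exact holderBd_zero_iff.2 ⟨(contDiff_mol h0 hu.1).continuous.continuousOn, hsup⟩
  · refine (holderBd_natCast_add_iff hα0 hα1).2 ⟨?_, hsup⟩
    obtain ⟨k, β, hβ0, hβ1, hβk, rfl, hf⟩ := hu.exists_holderSemi hb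
    have hlB : l < B := by
      have h2 : (l : ℝ) < B := by
        rw [hB]
        push_cast
        linarith [Nat.le_ceil A]
      exact_mod_cast h2
    have hkl : k ≤ l := by
      rcases hβ0.eq_or_lt with h | h
      · rw [hβk h.symm]
        exact Nat.zero_le l
      · have h2 : (k : ℝ) < l + 1 := by linarith
        exact Nat.lt_succ_iff.1 (by exact_mod_cast h2)
    refine (H k l hkl β α h (2 * N) u hβ0 hα0 hα1 hba h0 h1 (by positivity) hf).mono ?_
    have hcS := hle k (by omega) l hlB
    have hq : 0 ≤ h ^ ((k + β) - (l + α)) * N := by positivity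
    nlinarith

theorem exists_holderBd_rich (n : ℕ) (A : ℝ) : ∃ C : ℝ, 0 < C ∧
    ∀ (M : ℕ) (a b h N : ℝ) (u : E' n → ℝ), 0 ≤ b → b ≤ a → a ≤ A → 0 < h →
      (∀ j < M, h * 4 ^ j ≤ 1 / 2) → HolderBd b N u →
      HolderBd a (C * h ^ (b - a) * N) (rich M h 0 u) := by
  obtain ⟨C, hC0, hC⟩ := exists_holderBd_mol n A
  obtain ⟨D, hD0, hD⟩ := exists_sum_abs_extrapWeight_le 0
  simp only [pow_zero, mul_one] at hD
  refine ⟨D * C, by positivity, fun M a b h N u hb hba haA h0 h1 hu => ?_⟩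
  have hN := hu.nonneg
  have hsum := HolderBd.sum_smul (a := a) (N := C * h ^ (b - a) * N) (Finset.range M)
    (extrapWeight M) (g := fun j => mol (h * 4 ^ j) u) (fun j hj => ?_)
  · have he : rich M h 0 u = fun x => ∑ j ∈ Finset.range M,
        extrapWeight M j • mol (h * 4 ^ j) u x := by
      funext x
      simp [rich]
    rw [he]
    exact hsum.mono ((mul_le_mul_of_nonneg_right (hD M) (by positivity)).trans_eq (by ring))
  · refine (hC a b (h * 4 ^ j) N u hb hba haA (by positivity)
      (by linarith [h1 j (Finset.mem_range.1 hj)]) hu).mono ?_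
    gcongr ?_ * ?_ * ?_
    refine Real.rpow_le_rpow_of_nonpos h0 ?_ (by linarith)
    exact le_mul_of_one_le_right h0.le (one_le_pow₀ (by norm_num))

theorem exists_holderBd_sub_rich (n : ℕ) (A : ℝ) : ∃ C : ℝ, 0 < C ∧
    ∀ (M : ℕ) (a b h N : ℝ) (u : E' n → ℝ), 0 ≤ a → a ≤ b → b ≤ A → ⌈A⌉₊ < M → 0 < h →
      (∀ j < M, h * 4 ^ j ≤ 1 / 2) → HolderBd b N u →
      HolderBd a (C * h ^ (b - a) * N) (fun y => u y - rich M h 0 u y) := by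
  obtain ⟨C, hC0, hC⟩ := exists_holderBd_rich n A
  obtain ⟨D, hD0, hD⟩ := exists_sum_abs_extrapWeight_le (⌈A⌉₊ + 1)
  refine ⟨(2 * (2 ^ (⌈A⌉₊ + 1) * D) + 1) + C, by positivity,
    fun M a b h N u ha hab hbA hM h0 h1 hu => ?_⟩
  have hN := hu.nonneg
  rcases eq_zero_or_eq_natCast_add (ha.trans hab) with rfl | ⟨k, β, hβ0, hβ1, rfl⟩
  · obtain rfl : a = 0 := le_antisymm hab ha
    refine (hu.sub (hC M 0 0 h N u le_rfl le_rfl hbA h0 h1 hu)).mono ?_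
    rw [sub_self, Real.rpow_zero, mul_one, mul_one, add_mul]
    gcongr
    refine le_mul_of_one_le_left hN ?_
    have : 0 ≤ 2 ^ (⌈A⌉₊ + 1) * D := by positivity
    linarith
  · obtain ⟨hf, hsup⟩ := (holderBd_natCast_add_iff hβ0 hβ1).1 hu
    have hkA : k < ⌈A⌉₊ := Nat.lt_ceil.2 (by linarith)
    have hw : ∑ j ∈ Finset.range M, |extrapWeight M j| * ((4 : ℝ) ^ j) ^ (k + 1) ≤ D := by
      refine le_trans (Finset.sum_le_sum fun j _ => ?_) (hD M)
      gcongr ?_ * ?_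
      exact pow_le_pow_right₀ (one_le_pow₀ (by norm_num)) (by omega)
    have hh1 : h ≤ 1 := by
      have := h1 0 (by omega)
      rw [pow_zero, mul_one] at this
      linarith
    have h2 : (2 : ℝ) ^ (k + 1) ≤ 2 ^ (⌈A⌉₊ + 1) :=
      pow_le_pow_right₀ one_le_two (by omega)
    have hbound : ∀ y ∈ Ball n, |u y - rich M h 0 u y| ≤
        ((2 * (2 ^ (⌈A⌉₊ + 1) * D) + 1) + C) * h ^ ((k + β) - a) * N := by
      intro y hy
      refine (norm_sub_rich_le (r := 0) (by omega) h0 h1 hw hβ0 hβ1 hN hf hy).trans ?_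
      rw [← Real.rpow_natCast h k, ← Real.rpow_add h0, mul_comm N, ← mul_assoc]
      have h3 : h ^ ((k : ℝ) + β) ≤ h ^ ((k + β) - a) :=
        Real.rpow_le_rpow_of_exponent_ge h0 hh1 (by linarith)
      gcongr
      have : (2 : ℝ) ^ (k + 1) * D ≤ 2 ^ (⌈A⌉₊ + 1) * D := by gcongr
      nlinarith [mul_pos (pow_pos (two_pos (α := ℝ)) (⌈A⌉₊ + 1)) hD0]
    rcases eq_zero_or_eq_natCast_add ha with rfl | ⟨l, α, hα0, hα1, rfl⟩
    · exact holderBd_zero_iff.2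
        ⟨hu.1.sub (contDiff_rich h0 0 hu.1).continuous.continuousOn, hbound⟩
    · refine (holderBd_natCast_add_iff hα0 hα1).2 ⟨?_, hbound⟩
      have hlk : l ≤ k := by
        have h2 : (l : ℝ) < k + 1 := by linarith
        exact Nat.lt_succ_iff.1 (by exact_mod_cast h2)
      refine (holderSemi_sub_rich h0 hlk (by omega) h1 hw hβ0 hβ1 hα0 hα1 hab hN hf).mono ?_
      gcongr ?_ * _ * _
      have : (2 : ℝ) ^ (k + 1) * D ≤ 2 ^ (⌈A⌉₊ + 1) * D := by gcongr
      linarith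

theorem exists_holderBd_of_le (n : ℕ) (A : ℝ) : ∃ C : ℝ, 0 < C ∧
    ∀ (a b N : ℝ) (u : E' n → ℝ), 0 ≤ a → a ≤ b → b ≤ A → HolderBd b N u →
      HolderBd a (C * N) u := by
  obtain ⟨C, hC0, hC⟩ := exists_holderBd_rich n A
  obtain ⟨D, hD0, hD⟩ := exists_holderBd_sub_rich n A
  set M : ℕ := ⌈A⌉₊ + 1 with hM
  set h : ℝ := (2 * 4 ^ M)⁻¹ with hh
  have h0 : 0 < h := by positivity
  have h1 : ∀ j < M, h * 4 ^ j ≤ 1 / 2 := by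
    intro j hj
    rw [hh, inv_mul_le_iff₀ (by positivity)]
    have : (4 : ℝ) ^ j ≤ 4 ^ M := pow_le_pow_right₀ (by norm_num) hj.le
    linarith
  have hle : h ≤ 1 := inv_le_one_of_one_le₀ (by
    have : (1 : ℝ) ≤ 4 ^ M := one_le_pow₀ (by norm_num)
    linarith)
  refine ⟨D + C * h ^ (-A), by positivity, fun a b N u ha hab hbA hu => ?_⟩
  have hN := hu.nonneg
  have key := (hD M a b h N u ha hab hbA (by omega) h0 h1 hu).add
    (hC M a 0 h N u le_rfl ha (by linarith) h0 h1 hu.zero)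
  simp only [sub_add_cancel] at key
  refine key.mono ?_
  rw [add_mul]
  have h2 : h ^ (b - a) ≤ 1 := Real.rpow_le_one h0.le hle (by linarith)
  have h3 : h ^ (0 - a) ≤ h ^ (-A) := Real.rpow_le_rpow_of_exponent_ge h0 hle (by linarith)
  gcongr
  exact mul_le_of_le_one_right hD0.le h2

end holderBound

section smoothing

/-- The smoothing operator at frequency `θ`, on functions continuous on the ball. -/
def smoothing (θ : ℝ) (u : E' n → ℝ) : E' n → ℝ := rich (Nat.log 4 ⌊θ⌋₊ + 1) (2 * θ)⁻¹ 0 u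

theorem inv_two_mul_mul_four_pow_le {θ : ℝ} (hθ : 1 ≤ θ) :
    ∀ j < Nat.log 4 ⌊θ⌋₊ + 1, (2 * θ)⁻¹ * 4 ^ j ≤ 1 / 2 := by
  intro j hj
  have hfl : ⌊θ⌋₊ ≠ 0 := (Nat.floor_pos.2 hθ).ne'
  have h1 : (4 : ℝ) ^ j ≤ θ := by
    have h2 : 4 ^ j ≤ ⌊θ⌋₊ := (Nat.pow_le_pow_right (by norm_num) (by omega)).trans
      (Nat.pow_log_le_self 4 hfl)
    calc (4 : ℝ) ^ j ≤ ⌊θ⌋₊ := by exact_mod_cast h2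
      _ ≤ θ := Nat.floor_le (by linarith)
  rw [inv_mul_le_iff₀ (by linarith)]
  linarith

theorem inv_two_mul_rpow {θ : ℝ} (hθ : 1 ≤ θ) (a b : ℝ) :
    (2 * θ)⁻¹ ^ (b - a) = 2 ^ (a - b) * θ ^ (a - b) := by
  rw [Real.inv_rpow (by linarith), ← Real.rpow_neg (by linarith), neg_sub,
    Real.mul_rpow zero_le_two (by linarith)]

theorem exists_holderBd_smoothing (n : ℕ) (A : ℝ) : ∃ C : ℝ, 0 < C ∧
    ∀ (a b θ N : ℝ) (u : E' n → ℝ), 0 ≤ b → b ≤ a → a ≤ A → 1 ≤ θ → HolderBd b N u →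
      HolderBd a (C * θ ^ (a - b) * N) (smoothing θ u) := by
  obtain ⟨C, hC0, hC⟩ := exists_holderBd_rich n A
  refine ⟨C * 2 ^ A, by positivity, fun a b θ N u hb hba haA hθ hu => ?_⟩
  have hN := hu.nonneg
  refine (hC _ a b _ N u hb hba haA (by positivity) (inv_two_mul_mul_four_pow_le hθ) hu).mono ?_
  rw [inv_two_mul_rpow hθ, ← mul_assoc C]
  gcongr
  · exact one_le_two
  · linarith

theorem exists_holderBd_smoothing_of_le (n : ℕ) (A : ℝ) : ∃ C : ℝ, 0 < C ∧
    ∀ (a b θ N : ℝ) (u : E' n → ℝ), 0 ≤ a → a ≤ b → b ≤ A → 1 ≤ θ → HolderBd b N u →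
      HolderBd a (C * N) (smoothing θ u) := by
  obtain ⟨C, hC0, hC⟩ := exists_holderBd_smoothing n A
  obtain ⟨D, hD0, hD⟩ := exists_holderBd_of_le n A
  refine ⟨C * D, by positivity, fun a b θ N u ha hab hbA hθ hu => ?_⟩
  have key := hC a a θ (D * N) u ha le_rfl (by linarith) hθ (hD a b N u ha hab hbA hu)
  rwa [sub_self, Real.rpow_zero, mul_one, ← mul_assoc] at key

theorem exists_holderBd_sub_smoothing (n : ℕ) (A : ℝ) : ∃ C : ℝ, 0 < C ∧
    ∀ (a b θ N : ℝ) (u : E' n → ℝ), 0 ≤ a → a ≤ b → b ≤ A → 1 ≤ θ → HolderBd b N u →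
      HolderBd a (C * θ ^ (a - b) * N) (fun y => u y - smoothing θ u y) := by
  obtain ⟨C, hC0, hC⟩ := exists_holderBd_sub_rich n A
  obtain ⟨D, hD0, hD⟩ := exists_holderBd_of_le n A
  obtain ⟨L, hL0, hL⟩ := exists_holderBd_smoothing_of_le n A
  refine ⟨C + (D + L) * (4 ^ ⌈A⌉₊) ^ A, by positivity,
    fun a b θ N u ha hab hbA hθ hu => ?_⟩
  have hN := hu.nonneg
  have hθ0 : 0 < θ := by linarith
  rcases le_or_gt ((4 : ℝ) ^ ⌈A⌉₊) θ with h | h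
  · have hM : ⌈A⌉₊ < Nat.log 4 ⌊θ⌋₊ + 1 := Nat.lt_succ_iff.2
      (Nat.le_log_of_pow_le (by norm_num) (Nat.le_floor (by exact_mod_cast h)))
    refine (hC _ a b _ N u ha hab hbA hM (by positivity)
      (inv_two_mul_mul_four_pow_le hθ) hu).mono ?_
    rw [inv_two_mul_rpow hθ]
    have h2 : (2 : ℝ) ^ (a - b) ≤ 1 := Real.rpow_le_one_of_one_le_of_nonpos one_le_two (by linarith)
    have h3 : 2 ^ (a - b) * θ ^ (a - b) ≤ θ ^ (a - b) :=
      mul_le_of_le_one_left (by positivity) h2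
    have h4 : C ≤ C + (D + L) * (4 ^ ⌈A⌉₊) ^ A := le_add_of_nonneg_right (by positivity)
    gcongr
  · refine ((hD a b N u ha hab hbA hu).sub (hL a b θ N u ha hab hbA hθ hu)).mono ?_
    rw [← add_mul]
    gcongr ?_ * N
    have h2 : 1 ≤ (4 ^ ⌈A⌉₊) ^ A * θ ^ (a - b) := by
      calc (1 : ℝ) = θ ^ A * θ ^ (-A) := by
            rw [← Real.rpow_add hθ0, add_neg_cancel, Real.rpow_zero]
        _ ≤ (4 ^ ⌈A⌉₊) ^ A * θ ^ (a - b) := by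
            gcongr
            · linarith
            · linarith
    calc D + L ≤ (D + L) * ((4 ^ ⌈A⌉₊) ^ A * θ ^ (a - b)) :=
          le_mul_of_one_le_right (by positivity) h2
      _ = (D + L) * (4 ^ ⌈A⌉₊) ^ A * θ ^ (a - b) := by ring
      _ ≤ _ := by
          gcongr
          linarith

theorem exists_holderBd_smoothing_sub (n : ℕ) (A : ℝ) : ∃ C : ℝ, 0 < C ∧
    ∀ (a b θ N : ℝ) (u : E' n → ℝ), 0 ≤ a → a ≤ A → 0 ≤ b → b ≤ A → 1 ≤ θ → HolderBd b N u →
      HolderBd a (C * θ ^ (a - b) * N) (fun y => smoothing (2 * θ) u y - smoothing θ u y) := by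
  obtain ⟨C, hC0, hC⟩ := exists_holderBd_smoothing n A
  obtain ⟨D, hD0, hD⟩ := exists_holderBd_sub_smoothing n A
  refine ⟨C * 2 ^ A + C + 2 * D, by positivity, fun a b θ N u ha haA hb hbA hθ hu => ?_⟩
  have hN := hu.nonneg
  have hθ0 : 0 < θ := by linarith
  have hθN : 0 ≤ θ ^ (a - b) * N := by positivity
  rcases le_total b a with h | h
  · refine ((hC a b (2 * θ) N u hb h haA (by linarith) hu).sub
      (hC a b θ N u hb h haA hθ hu)).mono ?_
    rw [Real.mul_rpow zero_le_two hθ0.le, ← add_mul]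
    gcongr ?_ * N
    have h2 : (2 : ℝ) ^ (a - b) ≤ 2 ^ A :=
      Real.rpow_le_rpow_of_exponent_le one_le_two (by linarith)
    rw [← mul_assoc, ← add_mul]
    gcongr ?_ * _
    nlinarith
  · have key := (hD a b θ N u ha h hbA hθ hu).sub (hD a b (2 * θ) N u ha h hbA (by linarith) hu)
    simp only [sub_sub_sub_cancel_left] at key
    refine key.mono ?_
    rw [Real.mul_rpow zero_le_two hθ0.le, ← add_mul]
    gcongr ?_ * N
    have h2 : (2 : ℝ) ^ (a - b) ≤ 1 := Real.rpow_le_one_of_one_le_of_nonpos one_le_two (by linarith)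
    rw [← mul_assoc, ← add_mul]
    gcongr ?_ * _
    have : 0 < C * 2 ^ A := by positivity
    nlinarith

variable (n) in
/-- Extension of the smoothing operators to linear operators on all functions. -/
theorem exists_linear_smoothing : ∃ S : ℝ → (E' n → ℝ) → (E' n → ℝ),
    (∀ θ : ℝ, 1 ≤ θ → IsLinearMap ℝ (S θ)) ∧
    (∀ θ : ℝ, 1 ≤ θ → ∀ u : E' n → ℝ, ContDiff ℝ (⊤ : ℕ∞) (S θ u)) ∧
    ∀ θ : ℝ, 1 ≤ θ → ∀ u : E' n → ℝ, ContinuousOn u (Ball n) → S θ u = smoothing θ u := by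
  have hex : ∀ θ : ℝ, ∃ S : (E' n → ℝ) → (E' n → ℝ), 1 ≤ θ → IsLinearMap ℝ S ∧
      (∀ u : E' n → ℝ, ContDiff ℝ (⊤ : ℕ∞) (S u)) ∧
      ∀ u : E' n → ℝ, ContinuousOn u (Ball n) → S u = smoothing θ u := by
    intro θ
    by_cases hθ : 1 ≤ θ
    swap
    · exact ⟨id, fun h => absurd h hθ⟩
    let V : Submodule ℝ (E' n → ℝ) :=
      { carrier := {u | ContinuousOn u (Ball n)}
        add_mem' := fun hu hv => ContinuousOn.add hu hv
        zero_mem' := continuousOn_const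
        smul_mem' := fun c _ hu => ContinuousOn.const_smul hu c }
    let W : Submodule ℝ (E' n → ℝ) :=
      { carrier := {u | ContDiff ℝ (⊤ : ℕ∞) u}
        add_mem' := fun {u v} (hu : ContDiff ℝ (⊤ : ℕ∞) u) (hv : ContDiff ℝ (⊤ : ℕ∞) v) => hu.add hv
        zero_mem' := (contDiff_const : ContDiff ℝ (⊤ : ℕ∞) fun _ : E' n => (0 : ℝ))
        smul_mem' := fun c u (hu : ContDiff ℝ (⊤ : ℕ∞) u) => hu.const_smul c }
    let T : V →ₗ[ℝ] W :=
      { toFun := fun u => ⟨smoothing θ u.1, contDiff_rich (by positivity) 0 u.2⟩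
        map_add' := fun u v => by
          ext x
          simp only [smoothing, rich, Submodule.coe_add, Pi.add_apply, mol_add _ u.2 v.2, smul_add,
            Finset.sum_add_distrib]
        map_smul' := fun c u => by
          ext x
          simp only [smoothing, rich, Submodule.coe_smul, mol_smul, Pi.smul_apply, RingHom.id_apply,
            Finset.smul_sum]
          exact Finset.sum_congr rfl fun j _ => smul_comm _ _ _ }
    obtain ⟨g, hg⟩ := LinearMap.exists_extend T
    refine ⟨fun u => (g u).1, fun _ => ⟨(W.subtype ∘ₗ g).isLinear, fun u => (g u).2,
      fun u hu => ?_⟩⟩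
    exact congrArg Subtype.val (LinearMap.congr_fun hg ⟨u, hu⟩)
  choose S hS using hex
  exact ⟨S, fun θ hθ => (hS θ hθ).1, fun θ hθ => (hS θ hθ).2.1, fun θ hθ => (hS θ hθ).2.2⟩

end smoothing

section holderNorm

theorem le_biSup_of_nonneg {ι : Type*} {s : Set ι} {f : ι → ℝ} {B : ℝ} (hB : 0 ≤ B)
    (hf : ∀ y ∈ s, f y ≤ B) {x : ι} (hx : x ∈ s) : f x ≤ ⨆ y ∈ s, f y := by
  refine le_ciSup_of_le ⟨B, ?_⟩ x (by rw [ciSup_pos hx])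
  rintro _ ⟨y, rfl⟩
  exact Real.iSup_le (fun hy => hf y hy) hB

theorem biSup_le_of_nonneg {ι : Type*} {s : Set ι} {f : ι → ℝ} {B : ℝ} (hB : 0 ≤ B)
    (hf : ∀ y ∈ s, f y ≤ B) : ⨆ y ∈ s, f y ≤ B :=
  Real.iSup_le (fun y => Real.iSup_le (fun hy => hf y hy) hB) hB

theorem HolderFin.holderBd {b : ℝ} {u : E' n → ℝ} (hu : HolderFin (Ball n) b u) :
    HolderBd b (holderW (Ball n) b u) u := by
  obtain ⟨h1, ⟨B, hB⟩, ⟨B', hB'⟩⟩ := hu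
  have hsup : ∀ y ∈ Ball n, |u y| ≤ ⨆ y ∈ Ball n, |u y| := by
    intro y hy
    refine le_biSup_of_nonneg (f := fun y => |u y|) (le_max_right B' 0) (fun z hz => ?_) hy
    exact (hB' (mem_image_of_mem _ hz)).trans (le_max_left _ _)
  have hsup0 : 0 ≤ ⨆ y ∈ Ball n, |u y| :=
    Real.iSup_nonneg fun y => Real.iSup_nonneg fun _ => abs_nonneg _
  rcases le_or_gt b 0 with hb | hb
  · rw [holderW, if_pos hb]
    exact ⟨h1.continuousOn, hsup, fun h => absurd hb h.not_ge⟩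
  rw [holderW, if_neg hb.not_ge]
  set D : E' n → E' n → ℝ := fun z w =>
    ‖iteratedFDerivWithin ℝ (⌈b⌉₊ - 1) u (Ball n) z -
      iteratedFDerivWithin ℝ (⌈b⌉₊ - 1) u (Ball n) w‖ with hD
  set β : ℝ := b - ((⌈b⌉₊ : ℝ) - 1) with hβ
  have hquot0 : ∀ z w : E' n, 0 ≤ D z w / ‖z - w‖ ^ β := fun z w =>
    div_nonneg (norm_nonneg _) (Real.rpow_nonneg (norm_nonneg _) _)
  have hK0 : 0 ≤ ⨆ z ∈ Ball n, ⨆ w ∈ Ball n, D z w / ‖z - w‖ ^ β :=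
    Real.iSup_nonneg fun z => Real.iSup_nonneg fun _ => Real.iSup_nonneg fun w =>
      Real.iSup_nonneg fun _ => hquot0 z w
  have hK : ∀ z ∈ Ball n, ∀ w ∈ Ball n, D z w / ‖z - w‖ ^ β ≤
      ⨆ z ∈ Ball n, ⨆ w ∈ Ball n, D z w / ‖z - w‖ ^ β := by
    have hb' : ∀ z ∈ Ball n, ∀ w ∈ Ball n, D z w / ‖z - w‖ ^ β ≤ max B 0 := fun z hz w hw =>
      (hB (mem_image_of_mem (fun q : E' n × E' n => D q.1 q.2 / ‖q.1 - q.2‖ ^ β)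
        (mk_mem_prod hz hw))).trans (le_max_left _ _)
    intro z hz w hw
    refine (le_biSup_of_nonneg (f := fun w => D z w / ‖z - w‖ ^ β) (le_max_right B 0)
      (hb' z hz) hw).trans ?_
    exact le_biSup_of_nonneg (f := fun z => ⨆ w ∈ Ball n, D z w / ‖z - w‖ ^ β)
      (le_max_right B 0) (fun z hz => biSup_le_of_nonneg (le_max_right B 0) (hb' z hz)) hz
  refine ⟨h1.continuousOn, fun y hy => (hsup y hy).trans (le_add_of_nonneg_left hK0),
    fun _ => ⟨by exact_mod_cast h1, fun z hz w hw => ?_⟩⟩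
  rcases eq_or_ne z w with rfl | hzw
  · rw [sub_self, norm_zero]
    exact mul_nonneg (add_nonneg hK0 hsup0) (Real.rpow_nonneg (norm_nonneg _) _)
  · have hpos : 0 < ‖z - w‖ ^ β := Real.rpow_pos_of_pos (norm_pos_iff.2 (sub_ne_zero.2 hzw)) _
    rw [← div_le_iff₀ hpos]
    exact (hK z hz w hw).trans (le_add_of_nonneg_right hsup0)

theorem HolderBd.holderW_le {a N : ℝ} {u : E' n → ℝ} (hu : HolderBd a N u) :
    holderW (Ball n) a u ≤ 2 * N := by
  have hN := hu.nonneg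
  have hsup := biSup_le_of_nonneg hN hu.2.1
  rcases le_or_gt a 0 with ha | ha
  · rw [holderW, if_pos ha]
    linarith
  · rw [holderW, if_neg ha.not_ge, two_mul]
    refine add_le_add (biSup_le_of_nonneg hN fun z hz => biSup_le_of_nonneg hN fun w hw => ?_) hsup
    exact div_le_of_le_mul₀ (Real.rpow_nonneg (norm_nonneg _) _) hN ((hu.2.2 ha).2 z hz w hw)

end holderNorm

end smoothingOperators

/-- existence of smoothing operators on Hölder spaces of the unit
ball (Proposition 17.1). -/
theorem stmt18 (n : ℕ) (hn : 2 ≤ n) :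
    ∃ S : ℝ → (E' n → ℝ) → (E' n → ℝ),
      (∀ θ : ℝ, 1 ≤ θ → IsLinearMap ℝ (S θ)) ∧
      (∀ θ : ℝ, 1 ≤ θ → ∀ u : E' n → ℝ, ContDiff ℝ (⊤ : ℕ∞) (S θ u)) ∧
      ∀ A : ℝ, 0 < A → ∃ C > 0, ∀ a b : ℝ,
        a ∈ Icc (0:ℝ) A → b ∈ Icc (0:ℝ) A →
        ∀ θ : ℝ, 1 ≤ θ → ∀ u : E' n → ℝ, HolderFin (Ball n) b u →
          (a ≤ b → holderW (Ball n) a (S θ u) ≤ C * holderW (Ball n) b u) ∧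
          (b ≤ a → holderW (Ball n) a (S θ u) ≤ C * θ ^ (a - b) * holderW (Ball n) b u) ∧
          (a ≤ b → holderW (Ball n) a (fun y => u y - S θ u y) ≤
            C * θ ^ (a - b) * holderW (Ball n) b u) ∧
          (holderW (Ball n) a (fun y => S (2 * θ) u y - S θ u y) ≤
            C * θ ^ (a - b) * holderW (Ball n) b u) := by
  obtain ⟨S, hlin, hsmooth, hS⟩ := exists_linear_smoothing n
  refine ⟨S, hlin, hsmooth, fun A _ => ?_⟩
  obtain ⟨C₁, hC₁, h₁⟩ := exists_holderBd_smoothing_of_le n A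
  obtain ⟨C₂, hC₂, h₂⟩ := exists_holderBd_smoothing n A
  obtain ⟨C₃, hC₃, h₃⟩ := exists_holderBd_sub_smoothing n A
  obtain ⟨C₄, hC₄, h₄⟩ := exists_holderBd_smoothing_sub n A
  refine ⟨2 * (C₁ + C₂ + C₃ + C₄), by positivity, fun a b ha hb θ hθ u hu => ?_⟩
  have hB := hu.holderBd
  have hN := hB.nonneg
  have hθab : 0 ≤ θ ^ (a - b) := Real.rpow_nonneg (by linarith) _
  rw [hS θ hθ u hB.1, hS (2 * θ) (by linarith) u hB.1]
  have hle : ∀ {c : ℝ}, c ≤ C₁ + C₂ + C₃ + C₄ →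
      2 * (c * θ ^ (a - b) * holderW (Ball n) b u) ≤
        2 * (C₁ + C₂ + C₃ + C₄) * θ ^ (a - b) * holderW (Ball n) b u := fun hc => by
    rw [← mul_assoc, ← mul_assoc]
    gcongr
  refine ⟨fun hab => ?_, fun hba => ?_, fun hab => ?_, ?_⟩
  · refine (h₁ a b θ _ u ha.1 hab hb.2 hθ hB).holderW_le.trans ?_
    rw [← mul_assoc]
    gcongr
    linarith
  · exact (h₂ a b θ _ u hb.1 hba ha.2 hθ hB).holderW_le.trans (hle (by linarith))
  · exact (h₃ a b θ _ u ha.1 hab hb.2 hθ hB).holderW_le.trans (hle (by linarith))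
  · exact (h₄ a b θ _ u ha.1 ha.2 hb.1 hb.2 hθ hB).holderW_le.trans (hle (by linarith))

end
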